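/- arXiv:1905.04280 — 3 statements merged into one kernel-verified Lean document; each statement's English description precedes it below -/
import Mathlib

section
/- Key-length secrecy bound: With t = H(X^n|Y^n) + nδ₁ − log₂ ε₂ and the smoothed leftover hash lemma, if ℓ ≤ H(X^n|Z^n) − nδ' − t + 2 + 2 log₂(σ − 2ε'), where ε' = 2^{−nδ'²/(2log²(|X|+3))} < σ/2, then SD((h'_{S'}(X^n), h_S(X^n), S', S, Z^n); (U_ℓ, h_S(X^n), S', S, Z^n)) ≤ σ. -/
open scoped Classical

/-- Statistical distance between two distributions on a finite set. -/
noncomputable def SD {W : Type*} [Fintype W] (P Q : W → ℝ) : ℝ :=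
  (1 / 2) * ∑ w, |P w - Q w|

/-- Conditional probability `P_{A|B}(a|b)` of a joint distribution on `A × B`. -/
noncomputable def condProb {A B : Type*} [Fintype A] (P : A × B → ℝ) (a : A) (b : B) : ℝ :=
  P (a, b) / ∑ a' : A, P (a', b)

/-- Conditional Shannon entropy `H(A|B)` of a joint distribution on `A × B`. -/
noncomputable def condEnt {A B : Type*} [Fintype A] [Fintype B] (P : A × B → ℝ) : ℝ :=
  - ∑ a : A, ∑ b : B, P (a, b) * Real.logb 2 (condProb P a b)

/-- Marginal on `𝒳 × 𝒴` of a distribution on `𝒳 × 𝒴 × 𝒵`. -/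
noncomputable def margXY {𝒳 𝒴 𝒵 : Type*} [Fintype 𝒵] (P : 𝒳 × 𝒴 × 𝒵 → ℝ) :
    𝒳 × 𝒴 → ℝ := fun w => ∑ z : 𝒵, P (w.1, w.2, z)

/-- Marginal on `𝒳 × 𝒵` of a distribution on `𝒳 × 𝒴 × 𝒵`. -/
noncomputable def margXZ {𝒳 𝒴 𝒵 : Type*} [Fintype 𝒴] (P : 𝒳 × 𝒴 × 𝒵 → ℝ) :
    𝒳 × 𝒵 → ℝ := fun w => ∑ y : 𝒴, P (w.1, y, w.2)


lemma kls_exp_neg_le {y : ℝ} (hy : 0 ≤ y) : Real.exp (-y) ≤ 1 - y + y ^ 2 / 2 := by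
  have h1 := Real.quadratic_le_exp_of_nonneg hy
  rw [Real.exp_neg]
  have hpos : 0 < 1 + y + y ^ 2 / 2 := by positivity
  have h2 : (Real.exp y)⁻¹ ≤ (1 + y + y ^ 2 / 2)⁻¹ := inv_anti₀ hpos h1
  refine h2.trans ?_
  rw [inv_le_iff_one_le_mul₀ hpos]
  nlinarith [sq_nonneg (y ^ 2)]

lemma kls_concave : ConcaveOn ℝ (Set.Ici (3 : ℝ)) (fun y => Real.log y ^ 2) := by
  have hd : ∀ y : ℝ, 3 ≤ y → HasDerivAt (fun y => Real.log y ^ 2) (2 * (Real.log y / y)) y := by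
    intro y hy
    have := (Real.hasDerivAt_log (x := y) (by linarith)).fun_pow 2
    refine this.congr_deriv ?_
    simp only [Nat.cast_ofNat, Nat.add_one_sub_one, pow_one]
    ring
  apply AntitoneOn.concaveOn_of_deriv (convex_Ici 3)
  · intro y hy
    exact (hd y hy).continuousAt.continuousWithinAt
  · intro y hy
    rw [interior_Ici] at hy
    exact (hd y (le_of_lt hy)).differentiableAt.differentiableWithinAt
  · intro y hy w hw hyw
    rw [interior_Ici] at hy hw
    rw [(hd y (le_of_lt hy)).deriv, (hd w (le_of_lt hw)).deriv]
    have he : Real.exp 1 ≤ 3 := by linarith [Real.exp_one_lt_d9]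
    have := Real.log_div_self_antitoneOn (a := y) (b := w) (he.trans (le_of_lt hy))
      (he.trans (le_of_lt hw)) hyw
    simp only at this
    linarith

/-- second moment bound -/
lemma kls_second_moment {A B : Type*} [Fintype A] [Fintype B] (p : A × B → ℝ)
    (hp : ∀ w, 0 ≤ p w) (hs : ∑ w, p w = 1) :
    ∑ w : A × B, p w * Real.log (condProb p w.1 w.2) ^ 2
      ≤ Real.log ((Fintype.card A : ℝ) + 3) ^ 2 := by
  have hq : ∀ b, 0 ≤ ∑ a', p (a', b) := fun b => Finset.sum_nonneg fun _ _ => hp _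
  have hpq : ∀ w : A × B, p w ≤ ∑ a', p (a', w.2) := fun w =>
    Finset.single_le_sum (f := fun a' => p (a', w.2)) (fun _ _ => hp _) (Finset.mem_univ w.1)
  set u : A × B → ℝ := fun w => (∑ a', p (a', w.2)) / p w + 3 with hu
  have hu3 : ∀ w, 3 ≤ u w := fun w => by
    have : 0 ≤ (∑ a', p (a', w.2)) / p w := div_nonneg (hq _) (hp _)
    simp only [hu]; linarith
  have hJ := kls_concave.le_map_sum (t := Finset.univ) (w := p) (p := u)
    (fun w _ => hp w) hs (fun w _ => hu3 w)
  simp only [smul_eq_mul] at hJ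
  have h1 : ∑ w : A × B, p w * Real.log (condProb p w.1 w.2) ^ 2
      ≤ ∑ w, p w * Real.log (u w) ^ 2 := by
    apply Finset.sum_le_sum
    intro w _
    rcases (hp w).eq_or_lt with h0 | h0
    · simp [← h0]
    apply mul_le_mul_of_nonneg_left _ (hp w)
    have hc : condProb p w.1 w.2 = ((∑ a', p (a', w.2)) / p w)⁻¹ := by
      simp [condProb]
    have h1' : 1 ≤ (∑ a', p (a', w.2)) / p w := by
      rw [le_div_iff₀ h0]; simpa using hpq w
    rw [hc, Real.log_inv, neg_sq]
    apply pow_le_pow_left₀ (Real.log_nonneg h1')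
    apply Real.log_le_log (by linarith)
    simp [hu]
  have h2 : ∑ w, p w * u w ≤ (Fintype.card A : ℝ) + 3 := by
    have : ∀ w, p w * u w ≤ (∑ a', p (a', w.2)) + 3 * p w := by
      intro w
      rcases (hp w).eq_or_lt with h0 | h0
      · simp [← h0, hq]
      · simp only [hu]; rw [mul_add, mul_div_cancel₀ _ h0.ne']; linarith
    refine (Finset.sum_le_sum fun w _ => this w).trans ?_
    rw [Finset.sum_add_distrib, ← Finset.mul_sum, hs, Fintype.sum_prod_type]
    have hs' := hs
    rw [Fintype.sum_prod_type_right] at hs'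
    simp [hs']
  have h3 : 3 ≤ ∑ w, p w * u w := by
    have : ∑ w, p w * 3 ≤ ∑ w, p w * u w :=
      Finset.sum_le_sum fun w _ => mul_le_mul_of_nonneg_left (hu3 w) (hp w)
    rw [← Finset.sum_mul, hs] at this
    linarith
  refine h1.trans (hJ.trans ?_)
  apply pow_le_pow_left₀ (Real.log_nonneg (by linarith))
  exact Real.log_le_log (by linarith) h2

lemma kls_condEnt {A B : Type*} [Fintype A] [Fintype B] (p : A × B → ℝ) :
    condEnt p * Real.log 2 = - ∑ w : A × B, p w * Real.log (condProb p w.1 w.2) := by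
  unfold condEnt
  rw [Fintype.sum_prod_type, neg_mul, Finset.sum_mul]
  congr 1
  refine Finset.sum_congr rfl fun a _ => ?_
  rw [Finset.sum_mul]
  refine Finset.sum_congr rfl fun b _ => ?_
  rw [Real.logb, mul_assoc, div_mul_cancel₀]
  exact (Real.log_pos one_lt_two).ne'

lemma kls_mgf {A B : Type*} [Fintype A] [Fintype B] (p : A × B → ℝ)
    (hp : ∀ w, 0 ≤ p w) (hs : ∑ w, p w = 1) (lam : ℝ) (hl : 0 ≤ lam) :
    ∑ w : A × B, p w * Real.exp (lam * Real.log (condProb p w.1 w.2))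
      ≤ Real.exp (- lam * (condEnt p * Real.log 2)
          + lam ^ 2 * Real.log ((Fintype.card A : ℝ) + 3) ^ 2 / 2) := by
  have hlog : ∀ w : A × B, Real.log (condProb p w.1 w.2) ≤ 0 := fun w => by
    have hpq : p w ≤ ∑ a', p (a', w.2) :=
      Finset.single_le_sum (f := fun a' => p (a', w.2)) (fun _ _ => hp _) (Finset.mem_univ w.1)
    have hq : 0 ≤ ∑ a', p (a', w.2) := (hp w).trans hpq
    exact Real.log_nonpos (div_nonneg (hp _) hq) (div_le_one_of_le₀ hpq hq)
  have h1 : ∑ w : A × B, p w * Real.exp (lam * Real.log (condProb p w.1 w.2))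
      ≤ ∑ w : A × B, (p w + lam * (p w * Real.log (condProb p w.1 w.2))
        + lam ^ 2 / 2 * (p w * Real.log (condProb p w.1 w.2) ^ 2)) := by
    apply Finset.sum_le_sum
    intro w _
    have := kls_exp_neg_le (y := -(lam * Real.log (condProb p w.1 w.2)))
      (by nlinarith [mul_nonneg hl (neg_nonneg.2 (hlog w))])
    rw [neg_neg] at this
    refine (mul_le_mul_of_nonneg_left this (hp w)).trans (le_of_eq ?_)
    ring
  refine h1.trans ?_
  rw [Finset.sum_add_distrib, Finset.sum_add_distrib, ← Finset.mul_sum, ← Finset.mul_sum, hs,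
    kls_condEnt]
  have h2 := kls_second_moment p hp hs
  have h3 := mul_le_mul_of_nonneg_left h2 (by positivity : 0 ≤ lam ^ 2 / 2)
  refine le_trans ?_ (Real.add_one_le_exp _)
  linarith

/-- the tail bound -/
lemma kls_tail {A B : Type*} [Fintype A] [Fintype B] (n : ℕ) (p : Fin n → A × B → ℝ)
    (hp : ∀ j w, 0 ≤ p j w) (hs : ∀ j, ∑ w, p j w = 1) (δ : ℝ) (hδ : 0 < δ) :
    ∑ z : Fin n → B, ∑ x : Fin n → A,
      (if (∏ j, p j (x j, z j)) ≤
          Real.exp (-(((∑ j, condEnt (p j)) - n * δ) * Real.log 2))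
            * ∏ j, ∑ a, p j (a, z j)
        then 0 else ∏ j, p j (x j, z j))
      ≤ (2 : ℝ) ^ (-((n : ℝ) * δ ^ 2)
        / (2 * (Real.logb 2 ((Fintype.card A : ℝ) + 3)) ^ 2)) := by
  set K := ((∑ j, condEnt (p j)) - n * δ) * Real.log 2 with hK
  set L := Real.log ((Fintype.card A : ℝ) + 3) with hL
  have hLpos : 0 < L := Real.log_pos (by have : (0:ℝ) ≤ Fintype.card A := by positivity
                                         linarith)
  have hl2 : 0 < Real.log 2 := Real.log_pos one_lt_two
  set lam := δ * Real.log 2 / L ^ 2 with hlam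
  have hl0 : 0 < lam := by positivity
  have hpq : ∀ j (w : A × B), p j w ≤ ∑ a', p j (a', w.2) := fun j w =>
    Finset.single_le_sum (f := fun a' => p j (a', w.2)) (fun _ _ => hp _ _) (Finset.mem_univ w.1)
  have step : ∀ (z : Fin n → B) (x : Fin n → A),
      (if (∏ j, p j (x j, z j)) ≤ Real.exp (-K) * ∏ j, ∑ a, p j (a, z j)
        then 0 else ∏ j, p j (x j, z j))
      ≤ Real.exp (lam * K) *
        ∏ j, (p j (x j, z j) * Real.exp (lam * Real.log (condProb (p j) (x j) (z j)))) := by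
    intro z x
    split_ifs with hc
    · exact mul_nonneg (Real.exp_pos _).le (Finset.prod_nonneg fun j _ =>
        mul_nonneg (hp _ _) (Real.exp_pos _).le)
    · push Not at hc
      have hq0 : 0 ≤ ∏ j, ∑ a, p j (a, z j) :=
        Finset.prod_nonneg fun j _ => Finset.sum_nonneg fun a _ => hp _ _
      have hpos : 0 < ∏ j, p j (x j, z j) :=
        lt_of_le_of_lt (mul_nonneg (Real.exp_pos _).le hq0) hc
      have hpj : ∀ j, 0 < p j (x j, z j) := fun j => by
        refine lt_of_le_of_ne (hp _ _) fun h0 => hpos.ne' ?_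
        exact Finset.prod_eq_zero (Finset.mem_univ j) h0.symm
      have hqj : ∀ j, 0 < ∑ a, p j (a, z j) := fun j => (hpj j).trans_le (hpq j (x j, z j))
      have hqpos : 0 < ∏ j, ∑ a, p j (a, z j) := Finset.prod_pos fun j _ => hqj j
      have hlogs := Real.log_lt_log (by positivity) hc
      rw [Real.log_mul (Real.exp_pos _).ne' hqpos.ne', Real.log_exp,
        Real.log_prod (fun j _ => (hqj j).ne'), Real.log_prod (fun j _ => (hpj j).ne')] at hlogs
      rw [Finset.prod_mul_distrib, ← Real.exp_sum, ← Finset.mul_sum]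
      have : ∑ j, Real.log (condProb (p j) (x j) (z j))
          = ∑ j, Real.log (p j (x j, z j)) - ∑ j, Real.log (∑ a, p j (a, z j)) := by
        rw [← Finset.sum_sub_distrib]
        refine Finset.sum_congr rfl fun j _ => ?_
        rw [condProb, Real.log_div (hpj j).ne' (hqj j).ne']
      rw [this, mul_left_comm, ← Real.exp_add, ← mul_add]
      refine le_mul_of_one_le_right hpos.le (Real.one_le_exp (mul_nonneg hl0.le ?_))
      linarith
  refine (Finset.sum_le_sum fun z _ => Finset.sum_le_sum fun x _ => step z x).trans ?_
  have e1 : ∑ z : Fin n → B, ∑ x : Fin n → A, Real.exp (lam * K) *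
        ∏ j, (p j (x j, z j) * Real.exp (lam * Real.log (condProb (p j) (x j) (z j))))
      = Real.exp (lam * K) * ∏ j, ∑ w : A × B,
        p j w * Real.exp (lam * Real.log (condProb (p j) w.1 w.2)) := by
    simp_rw [← Finset.mul_sum]
    congr 1
    simp_rw [Fintype.sum_prod_type_right]
    rw [Finset.prod_univ_sum, Fintype.piFinset_univ]
    refine Finset.sum_congr rfl fun z _ => ?_
    rw [Finset.prod_univ_sum, Fintype.piFinset_univ]
  rw [e1]
  have e2 : ∏ j, ∑ w : A × B, p j w * Real.exp (lam * Real.log (condProb (p j) w.1 w.2))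
      ≤ ∏ j, Real.exp (- lam * (condEnt (p j) * Real.log 2) + lam ^ 2 * L ^ 2 / 2) :=
    Finset.prod_le_prod (fun j _ => Finset.sum_nonneg fun w _ =>
      mul_nonneg (hp _ _) (Real.exp_pos _).le) fun j _ => kls_mgf (p j) (hp j) (hs j) lam hl0.le
  refine (mul_le_mul_of_nonneg_left e2 (Real.exp_pos _).le).trans ?_
  rw [← Real.exp_sum, ← Real.exp_add, Real.rpow_def_of_pos two_pos]
  apply Real.exp_le_exp.2
  rw [Finset.sum_add_distrib, ← Finset.mul_sum, ← Finset.sum_mul]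
  simp only [Finset.sum_const, Finset.card_univ, Fintype.card_fin, nsmul_eq_mul, Real.logb]
  have e3 : lam * K + (-lam * ((∑ j, condEnt (p j)) * Real.log 2) + n * (lam ^ 2 * L ^ 2 / 2))
      = - (n * δ ^ 2 * Real.log 2 ^ 2 / (2 * L ^ 2)) := by
    rw [hK, hlam]; field_simp; ring
  have e4 : Real.log 2 * (-(↑n * δ ^ 2) / (2 * (L / Real.log 2) ^ 2))
      = - (n * δ ^ 2 * Real.log 2 ^ 2 / (2 * L ^ 2)) * Real.log 2 := by
    field_simp
  rw [e3, e4]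
  have hle1 : Real.log 2 ≤ 1 := by linarith [Real.log_two_lt_d9]
  have : 0 ≤ (n * δ ^ 2 * Real.log 2 ^ 2 / (2 * L ^ 2)) := by positivity
  nlinarith

/-- difference of real and ideal -/
noncomputable def klsD {X A B S S' : Type*} [Fintype X] (h : S → X → B) (h' : S' → X → A) (N : ℝ)
    (v : X → ℝ) (a : A) (b : B) (s' : S') (s : S) : ℝ :=
  ∑ x, v x * ((if h s x = b then 1 else 0) * ((if h' s' x = a then 1 else 0) - 1 / N))

lemma klsD_bad {X A B S S' : Type*} [Fintype X] [Fintype A] [Fintype B] [Fintype S] [Fintype S']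
    [Nonempty A]
    (h : S → X → B) (h' : S' → X → A) (v : X → ℝ) (hv : ∀ x, 0 ≤ v x) :
    ∑ a, ∑ b, ∑ s', ∑ s, |klsD h h' (Fintype.card A) v a b s' s|
      ≤ (Fintype.card S * Fintype.card S') * (2 * ∑ x, v x) := by
  have h1 : ∀ a b s' s, |klsD h h' (Fintype.card A) v a b s' s| ≤
      ∑ x, v x * ((if h s x = b then 1 else 0) *
        ((if h' s' x = a then 1 else 0) + 1 / (Fintype.card A : ℝ))) := by
    intro a b s' s
    refine (Finset.abs_sum_le_sum_abs _ _).trans (Finset.sum_le_sum fun x _ => ?_)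
    rw [abs_mul, abs_mul, abs_of_nonneg (hv x)]
    refine mul_le_mul_of_nonneg_left (mul_le_mul ?_ ?_ (abs_nonneg _) ?_) (hv x)
    · split_ifs <;> simp
    · have : 0 ≤ 1 / (Fintype.card A : ℝ) := by positivity
      rw [abs_le]; split_ifs <;> constructor <;> linarith
    · split_ifs <;> simp
  have h2 : ∀ s' s, ∑ a, ∑ b, |klsD h h' (Fintype.card A) v a b s' s| ≤ 2 * ∑ x, v x := by
    intro s' s
    refine (Finset.sum_le_sum fun a _ => Finset.sum_le_sum fun b _ => h1 a b s' s).trans ?_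
    have : ∀ a, ∑ b, ∑ x, v x * ((if h s x = b then 1 else 0) *
        ((if h' s' x = a then 1 else 0) + 1 / (Fintype.card A : ℝ)))
        = ∑ x, v x * ((if h' s' x = a then 1 else 0) + 1 / (Fintype.card A : ℝ)) := by
      intro a
      rw [Finset.sum_comm]
      refine Finset.sum_congr rfl fun x _ => ?_
      rw [← Finset.mul_sum, ← Finset.sum_mul]
      simp
    simp_rw [this]
    rw [Finset.sum_comm, Finset.mul_sum]
    refine Finset.sum_le_sum fun x _ => ?_
    rw [← Finset.mul_sum, Finset.sum_add_distrib]
    simp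
    linarith
  have h3 : ∑ a, ∑ b, ∑ s', ∑ s, |klsD h h' (Fintype.card A) v a b s' s|
      = ∑ s', ∑ s, ∑ a, ∑ b, |klsD h h' (Fintype.card A) v a b s' s| := by
    have : ∀ a, ∑ b, ∑ s', ∑ s, |klsD h h' (Fintype.card A) v a b s' s|
      = ∑ s', ∑ s, ∑ b, |klsD h h' (Fintype.card A) v a b s' s| := by
      intro a
      rw [Finset.sum_comm]
      exact Finset.sum_congr rfl fun s' _ => Finset.sum_comm
    simp_rw [this]
    rw [Finset.sum_comm]
    exact Finset.sum_congr rfl fun s' _ => Finset.sum_comm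
  rw [h3]
  refine (Finset.sum_le_sum fun s' _ => Finset.sum_le_sum fun s _ => h2 s' s).trans ?_
  simp
  linarith

lemma kls_swap {A B C D : Type*} [Fintype A] [Fintype B] [Fintype C] [Fintype D]
    (f : A → B → C → D → ℝ) :
    ∑ a, ∑ b, ∑ c, ∑ d, f a b c d = ∑ c, ∑ d, ∑ a, ∑ b, f a b c d := by
  have : ∀ a, ∑ b, ∑ c, ∑ d, f a b c d = ∑ c, ∑ d, ∑ b, f a b c d := by
    intro a
    rw [Finset.sum_comm]
    exact Finset.sum_congr rfl fun s' _ => Finset.sum_comm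
  simp_rw [this]
  rw [Finset.sum_comm]
  exact Finset.sum_congr rfl fun s' _ => Finset.sum_comm

lemma klsD_sq {X A B S S' : Type*} [Fintype X] [Fintype A] [Fintype B] [Fintype S] [Fintype S']
    [Nonempty A]
    (h : S → X → B) (h' : S' → X → A) (v : X → ℝ) (hv : ∀ x, 0 ≤ v x)
    (hu : ∀ x x', x ≠ x' → (∑ s', (if h' s' x = h' s' x' then (1 : ℝ) else 0))
      ≤ Fintype.card S' / Fintype.card A) :
    ∑ s', ∑ s, ∑ a, ∑ b, klsD h h' (Fintype.card A) v a b s' s ^ 2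
      ≤ (Fintype.card S * Fintype.card S') * ∑ x, v x ^ 2 := by
  have hA : (Fintype.card A : ℝ) ≠ 0 := by simp
  have hsum : ∀ s' s, ∑ a, ∑ b, klsD h h' (Fintype.card A) v a b s' s ^ 2
      = ∑ x, ∑ x', v x * v x' * ((if h s x = h s x' then 1 else 0) *
        ((if h' s' x = h' s' x' then 1 else 0) - 1 / (Fintype.card A : ℝ))) := by
    intro s' s
    have e : ∀ a b, klsD h h' (Fintype.card A) v a b s' s ^ 2 =
       ∑ x, ∑ x', v x * v x' * ((((if h' s' x = a then 1 else 0) - 1 / (Fintype.card A : ℝ)) *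
        ((if h' s' x' = a then 1 else 0) - 1 / (Fintype.card A : ℝ))) *
        ((if h s x = b then 1 else 0) * (if h s x' = b then 1 else 0))) := by
      intro a b
      rw [klsD, sq, Finset.sum_mul_sum]
      refine Finset.sum_congr rfl fun x _ => Finset.sum_congr rfl fun x' _ => ?_
      ring
    simp_rw [e]
    rw [kls_swap]
    refine Finset.sum_congr rfl fun x _ => Finset.sum_congr rfl fun x' _ => ?_
    simp_rw [← Finset.mul_sum, ← Finset.sum_mul]
    congr 1
    have e1 : ∑ b, ((if h s x = b then 1 else 0) * (if h s x' = b then (1:ℝ) else 0))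
        = if h s x = h s x' then 1 else 0 := by
      simp [eq_comm]
    have e2 : ∑ a, ((if h' s' x = a then 1 else 0) * (if h' s' x' = a then (1:ℝ) else 0))
        = if h' s' x = h' s' x' then 1 else 0 := by
      simp [eq_comm]
    rw [e1, mul_comm]
    congr 1
    simp_rw [sub_mul, mul_sub, Finset.sum_sub_distrib]
    rw [e2]
    simp [hA]
  simp_rw [hsum]
  rw [kls_swap]
  have e3 : ∀ x x', ∑ s', ∑ s, v x * v x' * ((if h s x = h s x' then 1 else 0) *
        ((if h' s' x = h' s' x' then 1 else 0) - 1 / (Fintype.card A : ℝ)))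
      ≤ if x = x' then (Fintype.card S * Fintype.card S') * v x ^ 2 else 0 := by
    intro x x'
    have e4 : ∑ s', ∑ s, v x * v x' * ((if h s x = h s x' then 1 else 0) *
        ((if h' s' x = h' s' x' then 1 else 0) - 1 / (Fintype.card A : ℝ)))
        = v x * v x' * ((∑ s, if h s x = h s x' then 1 else 0) *
          ((∑ s', if h' s' x = h' s' x' then 1 else 0) - Fintype.card S' / Fintype.card A)) := by
      simp_rw [← Finset.mul_sum, ← Finset.sum_mul, ← Finset.mul_sum]
      rw [Finset.sum_sub_distrib]
      simp [div_eq_mul_inv]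
    rw [e4]
    split_ifs with hx
    · subst hx
      simp only [if_true, Finset.sum_const, Finset.card_univ, nsmul_eq_mul, mul_one]
      have : 0 ≤ (Fintype.card S' : ℝ) / Fintype.card A := by positivity
      have h2 : 0 ≤ v x * v x * Fintype.card S := by
        have := hv x
        positivity
      nlinarith [mul_nonneg h2 this]
    · have h1 := hu x x' hx
      apply mul_nonpos_of_nonneg_of_nonpos (mul_nonneg (hv _) (hv _))
      apply mul_nonpos_of_nonneg_of_nonpos
      · exact Finset.sum_nonneg fun s _ => by split_ifs <;> simp
      · linarith
  refine (Finset.sum_le_sum fun x _ => Finset.sum_le_sum fun x' _ => e3 x x').trans ?_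
  simp [Finset.mul_sum]

lemma klsD_good {X A B S S' : Type*} [Fintype X] [Fintype A] [Fintype B] [Fintype S] [Fintype S']
    [Nonempty A]
    (h : S → X → B) (h' : S' → X → A) (v : X → ℝ) (hv : ∀ x, 0 ≤ v x)
    (hu : ∀ x x', x ≠ x' → (∑ s', (if h' s' x = h' s' x' then (1 : ℝ) else 0))
      ≤ Fintype.card S' / Fintype.card A) :
    ∑ a, ∑ b, ∑ s', ∑ s, |klsD h h' (Fintype.card A) v a b s' s|
      ≤ (Fintype.card S * Fintype.card S') *
        Real.sqrt (Fintype.card A * Fintype.card B * ∑ x, v x ^ 2) := by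
  have h1 := klsD_sq h h' v hv hu
  rw [kls_swap]
  have h2 : ∑ s', ∑ s, ∑ a, ∑ b, |klsD h h' (Fintype.card A) v a b s' s|
      = ∑ w : S' × S × A × B, |klsD h h' (Fintype.card A) v w.2.2.1 w.2.2.2 w.1 w.2.1| := by
    simp_rw [Fintype.sum_prod_type]
  have h3 : ∑ s', ∑ s, ∑ a, ∑ b, klsD h h' (Fintype.card A) v a b s' s ^ 2
      = ∑ w : S' × S × A × B, klsD h h' (Fintype.card A) v w.2.2.1 w.2.2.2 w.1 w.2.1 ^ 2 := by
    simp_rw [Fintype.sum_prod_type]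
  rw [h2]
  rw [h3] at h1
  have h4 := sq_sum_le_card_mul_sum_sq (s := (Finset.univ : Finset (S' × S × A × B)))
    (f := fun w => |klsD h h' (Fintype.card A) v w.2.2.1 w.2.2.2 w.1 w.2.1|)
  simp only [sq_abs, Finset.card_univ, Fintype.card_prod, Nat.cast_mul] at h4
  have hSS : (0:ℝ) ≤ Fintype.card S * Fintype.card S' := by positivity
  have hv2 : 0 ≤ ∑ x, v x ^ 2 := Finset.sum_nonneg fun x _ => sq_nonneg _
  apply le_of_sq_le_sq _ (by positivity)
  rw [mul_pow, Real.sq_sqrt (by positivity)]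
  refine h4.trans ?_
  refine (mul_le_mul_of_nonneg_left h1 (by positivity)).trans (le_of_eq ?_)
  ring

lemma klsD_main {X A B S S' : Type*} [Fintype X] [Fintype A] [Fintype B] [Fintype S] [Fintype S']
    [Nonempty A]
    (h : S → X → B) (h' : S' → X → A) (v : X → ℝ) (hv : ∀ x, 0 ≤ v x) (c : ℝ) (hc : 0 ≤ c)
    (hu : ∀ x x', x ≠ x' → (∑ s', (if h' s' x = h' s' x' then (1 : ℝ) else 0))
      ≤ Fintype.card S' / Fintype.card A) :
    ∑ a, ∑ b, ∑ s', ∑ s, |klsD h h' (Fintype.card A) v a b s' s|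
      ≤ (Fintype.card S * Fintype.card S') *
        (Real.sqrt (Fintype.card A * Fintype.card B * c) * (∑ x, v x)
          + 2 * ∑ x, if v x ≤ c * ∑ x', v x' then 0 else v x) := by
  set g : X → ℝ := fun x => if v x ≤ c * ∑ x', v x' then v x else 0 with hg
  set b : X → ℝ := fun x => if v x ≤ c * ∑ x', v x' then 0 else v x with hb
  have hgb : ∀ x, v x = g x + b x := fun x => by simp only [hg, hb]; split_ifs <;> simp
  have hg0 : ∀ x, 0 ≤ g x := fun x => by simp only [hg]; split_ifs <;> simp [hv]
  have hb0 : ∀ x, 0 ≤ b x := fun x => by simp only [hb]; split_ifs <;> simp [hv]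
  have hv0 : 0 ≤ ∑ x, v x := Finset.sum_nonneg fun x _ => hv x
  have hg2 : ∑ x, g x ^ 2 ≤ c * (∑ x, v x) ^ 2 := by
    have : ∀ x, g x ^ 2 ≤ (c * ∑ x', v x') * v x := by
      intro x
      simp only [hg]
      split_ifs with hx
      · rw [sq]; exact mul_le_mul_of_nonneg_right hx (hv x)
      · have := hv x
        simp; positivity
    refine (Finset.sum_le_sum fun x _ => this x).trans ?_
    rw [← Finset.mul_sum, sq, mul_assoc]
  have hD : ∀ a b' s' s, |klsD h h' (Fintype.card A) v a b' s' s|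
      ≤ |klsD h h' (Fintype.card A) g a b' s' s| + |klsD h h' (Fintype.card A) b a b' s' s| := by
    intro a b' s' s
    refine le_trans (le_of_eq ?_) (abs_add_le _ _)
    congr 1
    simp only [klsD]
    rw [← Finset.sum_add_distrib]
    refine Finset.sum_congr rfl fun x _ => ?_
    rw [hgb x]; ring
  refine (Finset.sum_le_sum fun a _ => Finset.sum_le_sum fun b' _ => Finset.sum_le_sum fun s' _ =>
    Finset.sum_le_sum fun s _ => hD a b' s' s).trans ?_
  simp_rw [Finset.sum_add_distrib]
  rw [mul_add]
  refine add_le_add ((klsD_good h h' g hg0 hu).trans ?_) (klsD_bad h h' b hb0)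
  refine mul_le_mul_of_nonneg_left ?_ (by positivity)
  rw [← Real.sqrt_sq hv0, ← Real.sqrt_mul (by positivity)]
  apply Real.sqrt_le_sqrt
  rw [mul_assoc _ c]
  exact mul_le_mul_of_nonneg_left hg2 (by positivity)

/-- key-length secrecy bound, Theorem 2 secrecy part: with
`t = H(X^n|Y^n) + nδ₁ − log₂ ε₂`, `ε' = 2^{−nδ'²/(2 log²(|X|+3))} < σ/2` and
`ℓ ≤ H(X^n|Z^n) − nδ' − t + 2 + 2 log₂(σ − 2ε')`, the extracted key is
`σ`-close to uniform given Eve's view `(h_S(X^n), S', S, Z^n)`. -/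
theorem key_length_secrecy
    {𝒳 𝒴 𝒵 S S' : Type*} [Fintype 𝒳] [Fintype 𝒴] [Fintype 𝒵]
    [Fintype S] [Fintype S'] [Nonempty S] [Nonempty S']
    (n t ℓ : ℕ)
    (P : Fin n → 𝒳 × 𝒴 × 𝒵 → ℝ)
    (hP : ∀ j, (∀ w, 0 ≤ P j w) ∧ ∑ w, P j w = 1)
    (h : S → (Fin n → 𝒳) → (Fin t → Bool))
    (h' : S' → (Fin n → 𝒳) → (Fin ℓ → Bool))
    (huhf : ∀ x x' : Fin n → 𝒳, x ≠ x' →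
      ((Finset.univ.filter (fun s => h s x = h s x')).card : ℝ) / (Fintype.card S : ℝ)
        ≤ 1 / 2 ^ t)
    (huhf' : ∀ x x' : Fin n → 𝒳, x ≠ x' →
      ((Finset.univ.filter (fun s' => h' s' x = h' s' x')).card : ℝ) / (Fintype.card S' : ℝ)
        ≤ 1 / 2 ^ ℓ)
    (σ δ₁ δ' ε₂ ε' : ℝ) (hσ : 0 < σ) (hδ' : 0 < δ') (hε₂ : 0 < ε₂)
    (hε' : ε' = (2 : ℝ) ^ (-((n : ℝ) * δ' ^ 2)
        / (2 * (Real.logb 2 ((Fintype.card 𝒳 : ℝ) + 3)) ^ 2)))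
    (hε'σ : ε' < σ / 2)
    (ht : (t : ℝ) = (∑ j, condEnt (margXY (P j))) + n * δ₁ - Real.logb 2 ε₂)
    (hℓ : (ℓ : ℝ) ≤ (∑ j, condEnt (margXZ (P j))) - n * δ' - t + 2
        + 2 * Real.logb 2 (σ - 2 * ε')) :
    SD
      -- distribution of (h'_{S'}(X^n), h_S(X^n), S', S, Z^n)
      (fun w : (Fin ℓ → Bool) × (Fin t → Bool) × S' × S × (Fin n → 𝒵) =>
        (∑ xy ∈ Finset.univ.filter
            (fun xy : (Fin n → 𝒳) × (Fin n → 𝒴) =>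
              h' w.2.2.1 xy.1 = w.1 ∧ h w.2.2.2.1 xy.1 = w.2.1),
          ∏ j, P j (xy.1 j, xy.2 j, w.2.2.2.2 j))
          / ((Fintype.card S : ℝ) * (Fintype.card S' : ℝ)))
      -- distribution of (U_ℓ, h_S(X^n), S', S, Z^n)
      (fun w : (Fin ℓ → Bool) × (Fin t → Bool) × S' × S × (Fin n → 𝒵) =>
        (∑ xy ∈ Finset.univ.filter
            (fun xy : (Fin n → 𝒳) × (Fin n → 𝒴) => h w.2.2.2.1 xy.1 = w.2.1),
          ∏ j, P j (xy.1 j, xy.2 j, w.2.2.2.2 j))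
          / ((Fintype.card S : ℝ) * (Fintype.card S' : ℝ) * 2 ^ ℓ))
    ≤ σ := by
  set p : Fin n → 𝒳 × 𝒵 → ℝ := fun j => margXZ (P j) with hp
  have hp0 : ∀ j w, 0 ≤ p j w := fun j w => Finset.sum_nonneg fun y _ => (hP j).1 _
  have hp1 : ∀ j, ∑ w, p j w = 1 := by
    intro j
    rw [← (hP j).2]
    simp only [hp, margXZ, Fintype.sum_prod_type]
    exact Finset.sum_congr rfl fun x _ => Finset.sum_comm
  set v : (Fin n → 𝒵) → (Fin n → 𝒳) → ℝ := fun z x => ∏ j, p j (x j, z j) with hv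
  have hv0 : ∀ z x, 0 ≤ v z x := fun z x => Finset.prod_nonneg fun j _ => hp0 _ _
  have hvsum : ∀ z, ∑ x, v z x = ∏ j, ∑ a, p j (a, z j) := by
    intro z
    rw [Finset.prod_univ_sum, Fintype.piFinset_univ]
  have hvtot : ∑ z, ∑ x, v z x = 1 := by
    simp_rw [hvsum]
    rw [← Fintype.piFinset_univ, ← Finset.prod_univ_sum (fun _ => Finset.univ)
      (fun j b => ∑ a, p j (a, b))]
    refine Finset.prod_eq_one fun j _ => ?_
    rw [← Fintype.sum_prod_type_right, hp1]
  have hvy : ∀ z x, ∑ y : Fin n → 𝒴, ∏ j, P j (x j, y j, z j) = v z x := by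
    intro z x
    simp only [hv, hp, margXZ]
    rw [Finset.prod_univ_sum, Fintype.piFinset_univ]
  have htail := kls_tail n p hp0 hp1 δ' hδ'
  rw [← hε'] at htail
  simp only [← hvsum] at htail
  set c := Real.exp (-(((∑ j, condEnt (p j)) - n * δ') * Real.log 2)) with hc
  have hcpos : 0 < c := Real.exp_pos _
  have hcardA : (Fintype.card (Fin ℓ → Bool) : ℝ) = 2 ^ ℓ := by simp
  have hcardB : (Fintype.card (Fin t → Bool) : ℝ) = 2 ^ t := by simp
  have hS : (0 : ℝ) < Fintype.card S := by exact_mod_cast Fintype.card_pos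
  have hS' : (0 : ℝ) < Fintype.card S' := by exact_mod_cast Fintype.card_pos
  have hu : ∀ x x', x ≠ x' → (∑ s', (if h' s' x = h' s' x' then (1 : ℝ) else 0))
      ≤ Fintype.card S' / Fintype.card (Fin ℓ → Bool) := by
    intro x x' hx
    have := huhf' x x' hx
    rw [hcardA, Finset.sum_boole]
    rw [div_le_iff₀ hS'] at this
    calc _ ≤ _ := this
      _ = _ := by ring
  have hmain := fun z => klsD_main h h' (v z) (hv0 z) c hcpos.le (by convert hu)
  have hmain2 := Finset.sum_le_sum fun z (_ : z ∈ Finset.univ) => hmain z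
  rw [← Finset.mul_sum, Finset.sum_add_distrib, ← Finset.mul_sum, ← Finset.mul_sum, hvtot,
    mul_one] at hmain2
  -- the square root
  have hσε : 0 < σ - 2 * ε' := by linarith
  have hl2 : 0 < Real.log 2 := Real.log_pos one_lt_two
  have hsqrt : Real.sqrt (Fintype.card (Fin ℓ → Bool) * Fintype.card (Fin t → Bool) * c)
      ≤ 2 * (σ - 2 * ε') := by
    apply Real.sqrt_le_iff.2 ⟨by linarith, ?_⟩
    rw [hcardA, hcardB]
    have e1 : (2 : ℝ) ^ ℓ = Real.exp (ℓ * Real.log 2) := by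
      rw [Real.exp_nat_mul, Real.exp_log two_pos]
    have e2 : (2 : ℝ) ^ t = Real.exp (t * Real.log 2) := by
      rw [Real.exp_nat_mul, Real.exp_log two_pos]
    have e3 : (2 * (σ - 2 * ε')) ^ 2
        = Real.exp (2 * Real.log 2 + 2 * Real.log (σ - 2 * ε')) := by
      rw [← mul_add, ← Real.log_mul two_ne_zero hσε.ne']
      have := Real.exp_nat_mul (Real.log (2 * (σ - 2 * ε'))) 2
      rw [Real.exp_log (by linarith)] at this
      exact_mod_cast this.symm
    rw [e1, e2, e3, hc, ← Real.exp_add, ← Real.exp_add]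
    apply Real.exp_le_exp.2
    have h5 := mul_le_mul_of_nonneg_right hℓ hl2.le
    have h6 : Real.logb 2 (σ - 2 * ε') * Real.log 2 = Real.log (σ - 2 * ε') := by
      rw [Real.logb, div_mul_cancel₀ _ hl2.ne']
    simp only [hp] at *
    nlinarith
  have key : ∀ a b s' s z,
      |(∑ xy ∈ Finset.univ.filter
            (fun xy : (Fin n → 𝒳) × (Fin n → 𝒴) =>
              h' s' xy.1 = a ∧ h s xy.1 = b),
          ∏ j, P j (xy.1 j, xy.2 j, z j))
          / ((Fintype.card S : ℝ) * (Fintype.card S' : ℝ)) -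
        (∑ xy ∈ Finset.univ.filter
            (fun xy : (Fin n → 𝒳) × (Fin n → 𝒴) => h s xy.1 = b),
          ∏ j, P j (xy.1 j, xy.2 j, z j))
          / ((Fintype.card S : ℝ) * (Fintype.card S' : ℝ) * 2 ^ ℓ)|
      = ((Fintype.card S : ℝ) * (Fintype.card S' : ℝ))⁻¹ *
        |klsD h h' (Fintype.card (Fin ℓ → Bool)) (v z) a b s' s| := by
    intro a b s' s z
    have hC : ∀ (C : (Fin n → 𝒳) → Prop) [DecidablePred C], ∑ xy ∈ Finset.univ.filter
            (fun xy : (Fin n → 𝒳) × (Fin n → 𝒴) => C xy.1),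
          ∏ j, P j (xy.1 j, xy.2 j, z j) = ∑ x, if C x then v z x else 0 := by
      intro C _
      rw [Finset.sum_filter, Fintype.sum_prod_type]
      refine Finset.sum_congr rfl fun x _ => ?_
      by_cases hx : C x
      · simp [hx, hvy]
      · simp [hx]
    have hC1 := hC (fun x => h' s' x = a ∧ h s x = b)
    have hC2 := hC (fun x => h s x = b)
    have hpos : 0 < ((Fintype.card S : ℝ) * (Fintype.card S' : ℝ))⁻¹ := by positivity
    rw [← abs_of_pos hpos, ← abs_mul]
    congr 1
    trans ((Fintype.card S : ℝ) * (Fintype.card S' : ℝ))⁻¹ *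
      ((∑ x, if (h' s' x = a ∧ h s x = b) then v z x else 0) -
        (∑ x, if h s x = b then v z x else 0) / 2 ^ ℓ)
    · rw [← hC1, ← hC2, mul_sub, div_eq_inv_mul, ← mul_div_assoc]
      congr 1
      rw [← div_eq_inv_mul, div_div]
    · congr 1
      rw [klsD, hcardA, Finset.sum_div, ← Finset.sum_sub_distrib]
      refine Finset.sum_congr rfl fun x _ => ?_
      by_cases h1 : h' s' x = a <;> by_cases h2 : h s x = b <;> simp [h1, h2] <;> ring
  unfold SD
  simp only [Fintype.sum_prod_type]
  simp_rw [key, ← Finset.mul_sum]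
  have hre : ∑ a, ∑ b, ∑ s', ∑ s, ∑ z,
        |klsD h h' (Fintype.card (Fin ℓ → Bool)) (v z) a b s' s|
      = ∑ z, ∑ a, ∑ b, ∑ s', ∑ s,
        |klsD h h' (Fintype.card (Fin ℓ → Bool)) (v z) a b s' s| := by
    symm
    rw [Finset.sum_comm]
    refine Finset.sum_congr rfl fun a _ => ?_
    rw [Finset.sum_comm]
    refine Finset.sum_congr rfl fun b _ => ?_
    rw [Finset.sum_comm]
    refine Finset.sum_congr rfl fun s' _ => ?_
    rw [Finset.sum_comm]
  rw [hre]
  have hε0 : 0 < ε' := by rw [hε']; positivity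
  have hfin := hmain2.trans (mul_le_mul_of_nonneg_left (add_le_add hsqrt
    (mul_le_mul_of_nonneg_left htail two_pos.le)) (by positivity))
  have hfin2 := mul_le_mul_of_nonneg_left hfin
    (by positivity : 0 ≤ ((Fintype.card S : ℝ) * (Fintype.card S' : ℝ))⁻¹)
  rw [inv_mul_cancel_left₀ (by positivity)] at hfin2
  linarith
end

section
/- For independent (not necessarily identical) pairs, the achievable key length of Protocol Π_SKA satisfies: for any 0 < ε, σ < 1 there is an (ε,σ)-secret key of length ℓ = H(X^n|Z^n) − H(X^n|Y^n) + 2 + log₂(ε₂(σ − 2ε')²) − √(2n)·log₂(|X|+3)·(√(log₂(1/ε')) + √(log₂(1/ε₁))), where ε₁ + ε₂ = ε and ε' < σ/2. -/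
open scoped Classical

lemma psi_concave (s : ℝ) (hs0 : 0 ≤ s) (hs1 : s ≤ 1 / 2) :
    ConcaveOn ℝ (Set.Ici (4 : ℝ)) (fun u => Real.exp (s * Real.log u) - s * Real.log u) := by
  have hInter : interior (Set.Ici (4 : ℝ)) = Set.Ioi 4 := interior_Ici
  refine concaveOn_of_hasDerivWithinAt2_nonpos (convex_Ici 4)
    (f' := fun u => (Real.exp (s * Real.log u) - 1) * (s * u⁻¹))
    (f'' := fun u => (Real.exp (s * Real.log u) * (s * u⁻¹)) * (s * u⁻¹)
      + (Real.exp (s * Real.log u) - 1) * (s * (-(u ^ 2)⁻¹))) ?_ ?_ ?_ ?_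
  · intro u hu
    have hu' : (4 : ℝ) ≤ u := hu
    have : u ≠ 0 := by linarith
    have h1 := (Real.hasDerivAt_log this).const_mul s
    exact ((h1.exp.sub h1).continuousAt).continuousWithinAt
  · intro u hu
    rw [hInter] at hu ⊢
    have hu' : (4 : ℝ) < u := hu
    have : u ≠ 0 := by linarith
    have h1 := (Real.hasDerivAt_log this).const_mul s
    have h2 := h1.exp.sub h1
    refine (h2.congr_deriv ?_).hasDerivWithinAt
    ring
  · intro u hu
    rw [hInter] at hu ⊢
    have hu' : (4 : ℝ) < u := hu
    have : u ≠ 0 := by linarith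
    have h1 := (Real.hasDerivAt_log this).const_mul s
    have h3 := (hasDerivAt_inv this).const_mul s
    have h2 := (h1.exp.sub_const 1).mul h3
    exact h2.hasDerivWithinAt
  · intro u hu
    rw [hInter] at hu
    have hu' : (4 : ℝ) < u := hu
    have hu0 : 0 < u := by linarith
    have hlog : Real.log 4 ≤ Real.log u := Real.log_le_log (by norm_num) hu'.le
    have hb := rpow_one_add_le_one_add_mul_self (s := -(1/2 : ℝ)) (p := 2 * s)
      (by norm_num) (by linarith) (by linarith)
    have h4 : Real.log 4 = 2 * Real.log 2 := by
      rw [show (4 : ℝ) = 2 ^ 2 by norm_num, Real.log_pow]; norm_num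
    have he : (1 + -(1/2 : ℝ)) ^ (2 * s) = Real.exp (-(s * Real.log 4)) := by
      rw [Real.rpow_def_of_pos (by norm_num), h4]
      rw [show (1 + -(1/2 : ℝ)) = 2⁻¹ by norm_num, Real.log_inv]
      congr 1; ring
    rw [he] at hb
    set E := Real.exp (s * Real.log u) with hE
    have hmono : Real.exp (s * Real.log 4) ≤ E :=
      Real.exp_le_exp.mpr (mul_le_mul_of_nonneg_left hlog hs0)
    have hprod : Real.exp (-(s * Real.log 4)) * Real.exp (s * Real.log 4) = 1 := by
      rw [← Real.exp_add]; simp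
    have hpos := Real.exp_pos (s * Real.log 4)
    have key : 1 ≤ (1 - s) * E := by
      calc (1 : ℝ) = Real.exp (-(s * Real.log 4)) * Real.exp (s * Real.log 4) := hprod.symm
        _ ≤ (1 - s) * Real.exp (s * Real.log 4) := by
            apply mul_le_mul_of_nonneg_right _ hpos.le; linarith
        _ ≤ (1 - s) * E := mul_le_mul_of_nonneg_left hmono (by linarith)
    have heq : (E * (s * u⁻¹)) * (s * u⁻¹) + (E - 1) * (s * (-(u ^ 2)⁻¹))
        = s * (u ^ 2)⁻¹ * (1 - (1 - s) * E) := by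
      field_simp; ring
    show (E * (s * u⁻¹)) * (s * u⁻¹) + (E - 1) * (s * (-(u ^ 2)⁻¹)) ≤ 0
    rw [heq]
    apply mul_nonpos_of_nonneg_of_nonpos
    · positivity
    · linarith

lemma exp_sub_mono {x y : ℝ} (hx : 0 ≤ x) (hxy : x ≤ y) :
    Real.exp x - x ≤ Real.exp y - y := by
  have h1 : Real.exp y = Real.exp x * Real.exp (y - x) := by
    rw [← Real.exp_add]; congr 1; ring
  have h2 := Real.add_one_le_exp (y - x)
  have h3 := Real.add_one_le_exp x
  nlinarith [Real.exp_pos x]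

lemma exp_quad {a : ℝ} (h0 : 0 ≤ a) (h1 : a ≤ Real.log 2) :
    Real.exp a - a ≤ 1 + a ^ 2 / (2 * Real.log 2) := by
  have hl := Real.log_two_lt_d9
  have hl' := Real.log_two_gt_d9
  have hb := Real.exp_bound' h0 (by linarith) (n := 3) (by norm_num)
  norm_num [Finset.sum_range_succ, Nat.factorial] at hb
  have h3 : (18 / 25 : ℝ) ≤ 1 / (2 * Real.log 2) := by
    rw [le_div_iff₀ (by linarith)]; linarith
  have h4 : a ^ 2 / (2 * Real.log 2) = a ^ 2 * (1 / (2 * Real.log 2)) := by ring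
  rw [h4]
  have h5 : a ^ 2 * (18/25) ≤ a ^ 2 * (1 / (2 * Real.log 2)) :=
    mul_le_mul_of_nonneg_left h3 (sq_nonneg a)
  have h6 : a ^ 3 ≤ a ^ 2 * (7/10) := by nlinarith [sq_nonneg a]
  nlinarith [sq_nonneg a]

lemma exp_neg_quad {a : ℝ} (h0 : 0 ≤ a) :
    Real.exp (-a) ≤ Real.exp a - 2 * a := by
  have := Real.sinh_eq a
  have h2 : a ≤ Real.sinh a := Real.self_le_sinh_iff.mpr h0
  linarith

/-- Inverse conditional probability (set to one on null points). -/
noncomputable def invCond {A B : Type*} [Fintype A] (p : A × B → ℝ) (w : A × B) : ℝ :=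
  if p w = 0 then 1 else (∑ a' : A, p (a', w.2)) / p w

lemma invCond_ge {A B : Type*} [Fintype A] (p : A × B → ℝ) (hp : ∀ w, 0 ≤ p w) (w : A × B) :
    1 ≤ invCond p w := by
  unfold invCond
  split_ifs with h
  · exact le_rfl
  · have : 0 < p w := lt_of_le_of_ne (hp w) (Ne.symm h)
    rw [le_div_iff₀ this, one_mul]
    exact Finset.single_le_sum (f := fun a' => p (a', w.2)) (fun i _ => hp _) (Finset.mem_univ w.1)

lemma sum_invCond {A B : Type*} [Fintype A] [Fintype B] (p : A × B → ℝ)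
    (hp : ∀ w, 0 ≤ p w) (h1 : ∑ w, p w = 1) :
    ∑ w, p w * invCond p w ≤ Fintype.card A := by
  calc ∑ w, p w * invCond p w ≤ ∑ w : A × B, ∑ a' : A, p (a', w.2) := by
        apply Finset.sum_le_sum
        intro w _
        unfold invCond
        split_ifs with h
        · rw [h, zero_mul]; exact Finset.sum_nonneg (fun i _ => hp _)
        · rw [mul_div_cancel₀ _ h]
    _ = Fintype.card A := by
        rw [Fintype.sum_prod_type]
        simp only [Finset.sum_const, Finset.card_univ, nsmul_eq_mul]
        rw [Finset.sum_comm, ← Fintype.sum_prod_type (f := fun w : A × B => p w), h1, mul_one]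

lemma sum_log_invCond {A B : Type*} [Fintype A] [Fintype B] (p : A × B → ℝ) :
    ∑ w, p w * Real.log (invCond p w) = Real.log 2 * condEnt p := by
  unfold condEnt
  rw [← Fintype.sum_prod_type (f := fun w : A × B => p w * Real.logb 2 (condProb p w.1 w.2)),
    mul_neg, Finset.mul_sum, ← Finset.sum_neg_distrib]
  apply Finset.sum_congr rfl
  intro w _
  unfold invCond condProb Real.logb
  have hl : Real.log 2 ≠ 0 := (Real.log_pos (by norm_num)).ne'
  split_ifs with h
  · simp [h]
  · rw [← inv_div, Real.log_inv]; field_simp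

lemma sum_psi {A B : Type*} [Fintype A] [Fintype B] [Nonempty A] (p : A × B → ℝ)
    (hp : ∀ w, 0 ≤ p w) (h1 : ∑ w, p w = 1) (s : ℝ) (hs0 : 0 ≤ s)
    (hs : s * Real.log ((Fintype.card A : ℝ) + 3) ≤ Real.log 2) :
    ∑ w, p w * (Real.exp (s * Real.log (invCond p w)) - s * Real.log (invCond p w))
      ≤ 1 + (s * Real.log ((Fintype.card A : ℝ) + 3)) ^ 2 / (2 * Real.log 2) := by
  have hk : (1 : ℝ) ≤ Fintype.card A := by exact_mod_cast Fintype.card_pos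
  have hL : Real.log 4 ≤ Real.log ((Fintype.card A : ℝ) + 3) :=
    Real.log_le_log (by norm_num) (by linarith)
  have h4 : Real.log 4 = 2 * Real.log 2 := by
    rw [show (4 : ℝ) = 2 ^ 2 by norm_num, Real.log_pow]; norm_num
  have hl2 : 0 < Real.log 2 := Real.log_pos (by norm_num)
  have hs1 : s ≤ 1 / 2 := by
    by_contra hc
    push Not at hc
    nlinarith
  have hc := psi_concave s hs0 hs1
  refine le_trans ?_ (exp_quad (mul_nonneg hs0 (by linarith)) hs)
  have hU := invCond_ge p hp
  have hj := hc.le_map_sum (t := Finset.univ) (w := p) (p := fun w => invCond p w + 3)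
    (fun i _ => hp i) h1 (fun i _ => by
      show (4 : ℝ) ≤ _
      linarith [hU i])
  simp only [smul_eq_mul] at hj
  have hS : ∑ w, p w * (invCond p w + 3) ≤ (Fintype.card A : ℝ) + 3 := by
    simp only [mul_add, Finset.sum_add_distrib, ← Finset.sum_mul, h1]
    linarith [sum_invCond p hp h1]
  have hS4 : 4 ≤ ∑ w, p w * (invCond p w + 3) := by
    calc (4 : ℝ) = ∑ w, p w * 4 := by rw [← Finset.sum_mul, h1]; norm_num
      _ ≤ _ := Finset.sum_le_sum (fun w _ => mul_le_mul_of_nonneg_left (by linarith [hU w]) (hp w))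
  refine le_trans ?_ (hj.trans ?_)
  · apply Finset.sum_le_sum
    intro w _
    apply mul_le_mul_of_nonneg_left _ (hp w)
    apply exp_sub_mono
    · exact mul_nonneg hs0 (Real.log_nonneg (hU w))
    · exact mul_le_mul_of_nonneg_left
        (Real.log_le_log (by linarith [hU w]) (by linarith)) hs0
  · apply exp_sub_mono
    · exact mul_nonneg hs0 (Real.log_nonneg (by linarith))
    · exact mul_le_mul_of_nonneg_left
        (Real.log_le_log (by linarith) hS) hs0

/-- single letter moment generating bounds, both signs -/
lemma mgf_up {A B : Type*} [Fintype A] [Fintype B] [Nonempty A] (p : A × B → ℝ)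
    (hp : ∀ w, 0 ≤ p w) (h1 : ∑ w, p w = 1) (s : ℝ) (hs0 : 0 ≤ s)
    (hs : s * Real.log ((Fintype.card A : ℝ) + 3) ≤ Real.log 2) :
    ∑ w, p w * Real.exp (s * (Real.log (invCond p w) - Real.log 2 * condEnt p))
      ≤ Real.exp ((s * Real.log ((Fintype.card A : ℝ) + 3)) ^ 2 / (2 * Real.log 2)) := by
  have h := sum_psi p hp h1 s hs0 hs
  have hm := sum_log_invCond p
  set μ := Real.log 2 * condEnt p
  set Q := (s * Real.log ((Fintype.card A : ℝ) + 3)) ^ 2 / (2 * Real.log 2)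
  have e1 : ∑ w, p w * Real.exp (s * (Real.log (invCond p w) - μ))
      = (∑ w, p w * Real.exp (s * Real.log (invCond p w))) * Real.exp (-(s * μ)) := by
    rw [Finset.sum_mul]
    apply Finset.sum_congr rfl
    intro w _
    rw [mul_assoc, ← Real.exp_add]; ring_nf
  have e2 : ∑ w, p w * Real.exp (s * Real.log (invCond p w)) ≤ 1 + Q + s * μ := by
    have : ∑ w, p w * (Real.exp (s * Real.log (invCond p w)) - s * Real.log (invCond p w))
      = ∑ w, p w * Real.exp (s * Real.log (invCond p w)) - s * μ := by
      rw [← hm, Finset.mul_sum, ← Finset.sum_sub_distrib]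
      apply Finset.sum_congr rfl
      intro w _; ring
    linarith
  rw [e1]
  calc _ ≤ Real.exp (Q + s * μ) * Real.exp (-(s * μ)) := by
        apply mul_le_mul_of_nonneg_right _ (Real.exp_pos _).le
        linarith [Real.add_one_le_exp (Q + s * μ)]
    _ = _ := by rw [← Real.exp_add]; ring_nf

lemma mgf_down {A B : Type*} [Fintype A] [Fintype B] [Nonempty A] (p : A × B → ℝ)
    (hp : ∀ w, 0 ≤ p w) (h1 : ∑ w, p w = 1) (s : ℝ) (hs0 : 0 ≤ s)
    (hs : s * Real.log ((Fintype.card A : ℝ) + 3) ≤ Real.log 2) :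
    ∑ w, p w * Real.exp ((-s) * (Real.log (invCond p w) - Real.log 2 * condEnt p))
      ≤ Real.exp ((s * Real.log ((Fintype.card A : ℝ) + 3)) ^ 2 / (2 * Real.log 2)) := by
  have h := sum_psi p hp h1 s hs0 hs
  have hm := sum_log_invCond p
  set μ := Real.log 2 * condEnt p
  set Q := (s * Real.log ((Fintype.card A : ℝ) + 3)) ^ 2 / (2 * Real.log 2)
  have e1 : ∑ w, p w * Real.exp ((-s) * (Real.log (invCond p w) - μ))
      = (∑ w, p w * Real.exp (-(s * Real.log (invCond p w)))) * Real.exp (s * μ) := by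
    rw [Finset.sum_mul]
    apply Finset.sum_congr rfl
    intro w _
    rw [mul_assoc, ← Real.exp_add]; ring_nf
  have e2 : ∑ w, p w * Real.exp (-(s * Real.log (invCond p w))) ≤ 1 + Q - s * μ := by
    have : ∑ w, p w * (Real.exp (s * Real.log (invCond p w)) - s * Real.log (invCond p w))
      - s * μ = ∑ w, p w * (Real.exp (s * Real.log (invCond p w))
          - 2 * (s * Real.log (invCond p w))) := by
      rw [← hm, Finset.mul_sum, ← Finset.sum_sub_distrib]
      apply Finset.sum_congr rfl
      intro w _; ring
    have h3 : ∑ w, p w * Real.exp (-(s * Real.log (invCond p w))) ≤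
        ∑ w, p w * (Real.exp (s * Real.log (invCond p w))
          - 2 * (s * Real.log (invCond p w))) := by
      apply Finset.sum_le_sum
      intro w _
      apply mul_le_mul_of_nonneg_left _ (hp w)
      exact exp_neg_quad (mul_nonneg hs0 (Real.log_nonneg (invCond_ge p hp w)))
    linarith
  rw [e1]
  calc _ ≤ Real.exp (Q - s * μ) * Real.exp (s * μ) := by
        apply mul_le_mul_of_nonneg_right _ (Real.exp_pos _).le
        linarith [Real.add_one_le_exp (Q - s * μ)]
    _ = _ := by rw [← Real.exp_add]; ring_nf

lemma ent_nonneg {A B : Type*} [Fintype A] [Fintype B] (p : A × B → ℝ)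
    (hp : ∀ w, 0 ≤ p w) : 0 ≤ Real.log 2 * condEnt p := by
  rw [← sum_log_invCond]
  exact Finset.sum_nonneg fun w _ => mul_nonneg (hp w) (Real.log_nonneg (invCond_ge p hp w))

lemma ent_le {A B : Type*} [Fintype A] [Fintype B] [Nonempty A] (p : A × B → ℝ)
    (hp : ∀ w, 0 ≤ p w) (h1 : ∑ w, p w = 1) :
    Real.log 2 * condEnt p ≤ Real.log ((Fintype.card A : ℝ) + 3) := by
  rw [← sum_log_invCond]
  have hk : (1 : ℝ) ≤ Fintype.card A := by exact_mod_cast Fintype.card_pos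
  set K := (Fintype.card A : ℝ) + 3
  have hK : 0 < K := by simp only [K]; linarith
  calc _ ≤ ∑ w, (p w * invCond p w * K⁻¹ + p w * (Real.log K - 1)) := by
        apply Finset.sum_le_sum
        intro w _
        have hU := invCond_ge p hp w
        have := Real.log_le_sub_one_of_pos (x := invCond p w * K⁻¹) (by positivity)
        rw [Real.log_mul (by positivity) (by positivity), Real.log_inv] at this
        have := mul_le_mul_of_nonneg_left this (hp w)
        linarith
    _ = (∑ w, p w * invCond p w) * K⁻¹ + (Real.log K - 1) := by
        rw [Finset.sum_add_distrib, ← Finset.sum_mul, ← Finset.sum_mul, h1, one_mul]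
    _ ≤ K * K⁻¹ + (Real.log K - 1) := by
        have := sum_invCond p hp h1
        gcongr
        simp only [K]; linarith
    _ = _ := by rw [mul_inv_cancel₀ hK.ne']; ring

lemma prod_pair_sum {A B : Type*} [Fintype A] [Fintype B] {n : ℕ} (f : Fin n → A × B → ℝ) :
    ∑ a : Fin n → A, ∑ b : Fin n → B, ∏ j, f j (a j, b j) = ∏ j, ∑ w, f j w := by
  simp only [Fintype.sum_prod_type]
  rw [Fintype.prod_sum]
  apply Finset.sum_congr rfl
  intro a _
  rw [Fintype.prod_sum]

lemma chernoff {A B : Type*} [Fintype A] [Fintype B] {n : ℕ} (p : Fin n → A × B → ℝ)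
    (hp : ∀ j w, 0 ≤ p j w) (X : Fin n → A × B → ℝ) (Q D : ℝ)
    (hm : ∀ j, ∑ w, p j w * Real.exp (X j w) ≤ Real.exp Q)
    (Good : (Fin n → A) → (Fin n → B) → Prop)
    (hbad : ∀ a b, ¬ Good a b → ∏ j, p j (a j, b j) ≠ 0 → D ≤ ∑ j, X j (a j, b j)) :
    ∑ a : Fin n → A, ∑ b : Fin n → B, (if Good a b then 0 else ∏ j, p j (a j, b j))
      ≤ Real.exp (n * Q - D) := by
  calc _ ≤ ∑ a : Fin n → A, ∑ b : Fin n → B,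
        (∏ j, (p j (a j, b j) * Real.exp (X j (a j, b j)))) * Real.exp (-D) := by
        apply Finset.sum_le_sum; intro a _
        apply Finset.sum_le_sum; intro b _
        have h0 : 0 ≤ ∏ j, p j (a j, b j) := Finset.prod_nonneg fun j _ => hp j _
        rw [Finset.prod_mul_distrib, ← Real.exp_sum, mul_assoc, ← Real.exp_add]
        split_ifs with h
        · positivity
        · by_cases hz : ∏ j, p j (a j, b j) = 0
          · simp [hz]
          · have := hbad a b h hz
            have h1 : 1 ≤ Real.exp (∑ j, X j (a j, b j) + -D) :=
              Real.one_le_exp (by linarith)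
            nlinarith
    _ = (∏ j, ∑ w, p j w * Real.exp (X j w)) * Real.exp (-D) := by
        rw [← prod_pair_sum, Finset.sum_mul]
        simp only [Finset.sum_mul]
    _ ≤ (∏ _j : Fin n, Real.exp Q) * Real.exp (-D) := by
        apply mul_le_mul_of_nonneg_right _ (Real.exp_pos _).le
        apply Finset.prod_le_prod
        · intro j _
          exact Finset.sum_nonneg fun w _ => mul_nonneg (hp j w) (Real.exp_pos _).le
        · intro j _; exact hm j
    _ = _ := by
        rw [Finset.prod_const, ← Real.exp_nat_mul, ← Real.exp_add]
        simp [sub_eq_add_neg]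

lemma delta_calc {n : ℕ} (hn : 0 < n) (L ε : ℝ) (hL : 0 < L) (hε : 0 < ε) (hε1 : ε < 1)
    (Δ s : ℝ) (hΔ : Δ = Real.sqrt (2 * n) * L * Real.sqrt (Real.logb 2 (1 / ε)))
    (hs : s = Real.log 2 * Δ / (n * L ^ 2)) (hle : Δ ≤ n * L) :
    0 ≤ s ∧ s * L ≤ Real.log 2 ∧
      Real.exp (n * ((s * L) ^ 2 / (2 * Real.log 2)) - s * Δ) = ε := by
  have hl2 : 0 < Real.log 2 := Real.log_pos (by norm_num)
  have hn' : (0 : ℝ) < n := by exact_mod_cast hn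
  have hΔ0 : 0 ≤ Δ := by rw [hΔ]; positivity
  have hlb : 0 ≤ Real.logb 2 (1 / ε) := by
    apply Real.logb_nonneg (by norm_num)
    rw [le_div_iff₀ hε]; linarith
  have hsq : Δ ^ 2 = 2 * n * L ^ 2 * Real.logb 2 (1 / ε) := by
    rw [hΔ, mul_pow, mul_pow, Real.sq_sqrt (by positivity), Real.sq_sqrt hlb]
  refine ⟨by rw [hs]; positivity, ?_, ?_⟩
  · rw [hs, div_mul_eq_mul_div, div_le_iff₀ (by positivity)]
    have : Real.log 2 * Δ * L ≤ Real.log 2 * (n * L) * L := by gcongr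
    linarith
  · have : n * ((s * L) ^ 2 / (2 * Real.log 2)) - s * Δ
        = - (Real.log 2 * Δ ^ 2 / (2 * n * L ^ 2)) := by
      rw [hs]; field_simp; ring
    rw [this, hsq]
    have : Real.log 2 * (2 * n * L ^ 2 * Real.logb 2 (1 / ε)) / (2 * n * L ^ 2) = - Real.log ε := by
      unfold Real.logb
      rw [one_div, Real.log_inv]
      field_simp
    rw [this, neg_neg, Real.exp_log hε]

lemma prod_eq_invCond {A B : Type*} [Fintype A] {n : ℕ} (p : Fin n → A × B → ℝ)
    (hp : ∀ j w, 0 ≤ p j w) (a : Fin n → A) (b : Fin n → B) (h : ∏ j, p j (a j, b j) ≠ 0) :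
    ∏ j, p j (a j, b j) = (∏ j, ∑ a', p j (a', b j))
      * Real.exp (-∑ j, Real.log (invCond (p j) (a j, b j))) := by
  rw [← Finset.sum_neg_distrib, Real.exp_sum, ← Finset.prod_mul_distrib]
  apply Finset.prod_congr rfl
  intro j _
  have hj : p j (a j, b j) ≠ 0 := fun h0 => h (Finset.prod_eq_zero (Finset.mem_univ j) h0)
  have hU := invCond_ge (p j) (hp j) (a j, b j)
  rw [Real.exp_neg, Real.exp_log (by linarith)]
  have hS : ∑ a', p j (a', b j) ≠ 0 := by
    intro h0
    have : p j (a j, b j) ≤ ∑ a', p j (a', b j) :=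
      Finset.single_le_sum (f := fun a' => p j (a', b j)) (fun i _ => hp j _) (Finset.mem_univ (a j))
    exact hj (le_antisymm (this.trans h0.le) (hp j _))
  simp only [invCond, hj, if_false]
  field_simp

lemma typical_upper {A B : Type*} [Fintype A] [Fintype B] [Nonempty A] {n : ℕ} (hn : 0 < n)
    (p : Fin n → A × B → ℝ) (hp : ∀ j w, 0 ≤ p j w) (h1 : ∀ j, ∑ w, p j w = 1)
    (ε : ℝ) (hε : 0 < ε) (hε1 : ε < 1) (Δ : ℝ)
    (hΔ : Δ = Real.sqrt (2 * n) * Real.log ((Fintype.card A : ℝ) + 3)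
      * Real.sqrt (Real.logb 2 (1 / ε))) :
    ∃ T : (Fin n → A) → (Fin n → B) → Prop,
      (∑ a : Fin n → A, ∑ b : Fin n → B, (if T a b then 0 else ∏ j, p j (a j, b j))) ≤ ε ∧
      ∀ b, ((Finset.univ.filter (fun a => T a b)).card : ℝ)
        ≤ Real.exp (∑ j, Real.log 2 * condEnt (p j) + Δ) := by
  have hk : (1 : ℝ) ≤ Fintype.card A := by exact_mod_cast Fintype.card_pos
  set L := Real.log ((Fintype.card A : ℝ) + 3) with hLdef
  have hL : 0 < L := Real.log_pos (by linarith)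
  set H := ∑ j, Real.log 2 * condEnt (p j) with hH
  have hH0 : 0 ≤ H := Finset.sum_nonneg fun j _ => ent_nonneg (p j) (hp j)
  by_cases hle : Δ ≤ n * L
  · obtain ⟨hs0, hs1, hs2⟩ := delta_calc hn L ε hL hε hε1 Δ _ hΔ rfl hle
    set s := Real.log 2 * Δ / (n * L ^ 2)
    obtain ⟨T, hT⟩ : ∃ T : (Fin n → A) → (Fin n → B) → Prop, ∀ a b, T a b ↔
      (∏ j, p j (a j, b j) ≠ 0 ∧
        ∑ j, Real.log (invCond (p j) (a j, b j)) ≤ H + Δ) := ⟨_, fun _ _ => Iff.rfl⟩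
    refine ⟨T, ?_, ?_⟩
    · rw [← hs2]
      refine chernoff p hp (fun j w => s * (Real.log (invCond (p j) w) - Real.log 2 * condEnt (p j)))
        _ _ (fun j => mgf_up (p j) (hp j) (h1 j) s hs0 hs1) _ ?_
      intro a b hb hz
      have hb' : H + Δ < ∑ j, Real.log (invCond (p j) (a j, b j)) := by
        by_contra hc
        exact hb ((hT a b).mpr ⟨hz, not_lt.mp hc⟩)
      rw [← Finset.mul_sum, Finset.sum_sub_distrib]
      apply mul_le_mul_of_nonneg_left _ hs0
      linarith
    · intro b
      by_cases hb : ∏ j, ∑ a', p j (a', b j) = 0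
      · have : (Finset.univ.filter (fun a : Fin n → A => T a b)) = ∅ := by
          apply Finset.filter_eq_empty_iff.mpr
          intro a _ hTa
          have hz := ((hT a b).mp hTa).1
          have := prod_eq_invCond p hp a b hz
          rw [hb, zero_mul] at this
          exact hz this
        rw [this]
        simp only [Finset.card_empty, Nat.cast_zero]
        positivity
      · have hb0 : 0 < ∏ j, ∑ a', p j (a', b j) :=
          lt_of_le_of_ne (Finset.prod_nonneg fun j _ => Finset.sum_nonneg fun i _ => hp j _)
            (Ne.symm hb)
        set R := ∏ j, ∑ a', p j (a', b j) with hR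
        set F := (Finset.univ.filter (fun a : Fin n → A => T a b)) with hF
        have hsum : (F.card : ℝ) * (R * Real.exp (-(H + Δ))) ≤ R := by
          calc (F.card : ℝ) * (R * Real.exp (-(H + Δ)))
              = ∑ a ∈ F, R * Real.exp (-(H + Δ)) := by
                rw [Finset.sum_const, nsmul_eq_mul]
            _ ≤ ∑ a ∈ F, ∏ j, p j (a j, b j) := by
                apply Finset.sum_le_sum
                intro a ha
                obtain ⟨hz, hz2⟩ := (hT a b).mp (Finset.mem_filter.mp ha).2
                rw [prod_eq_invCond p hp a b hz]
                gcongr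
            _ ≤ ∑ a : Fin n → A, ∏ j, p j (a j, b j) := by
                apply Finset.sum_le_sum_of_subset_of_nonneg (Finset.subset_univ _)
                intro a _ _
                exact Finset.prod_nonneg fun j _ => hp j _
            _ = R := by
                rw [hR, Fintype.prod_sum]
        have h3 : (F.card : ℝ) * Real.exp (-(H + Δ)) ≤ 1 := by
          by_contra hc
          push Not at hc
          nlinarith
        rw [Real.exp_neg] at h3
        have h4 := Real.exp_pos (H + Δ)
        calc (F.card : ℝ) = (F.card : ℝ) * (Real.exp (H + Δ))⁻¹ * Real.exp (H + Δ) := by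
              field_simp
          _ ≤ 1 * Real.exp (H + Δ) := by gcongr
          _ = _ := one_mul _
  · push Not at hle
    obtain ⟨T, hT⟩ : ∃ T : (Fin n → A) → (Fin n → B) → Prop, ∀ a b, T a b :=
      ⟨fun _ _ => True, fun _ _ => trivial⟩
    refine ⟨T, by simpa [hT] using hε.le, ?_⟩
    intro b
    have hc : Fintype.card (Fin n → A) = Fintype.card A ^ n := by
      simp
    refine le_trans (Nat.cast_le.mpr (Finset.card_filter_le _ _)) ?_
    rw [Finset.card_univ, hc]
    push_cast
    calc (Fintype.card A : ℝ) ^ n ≤ ((Fintype.card A : ℝ) + 3) ^ n := by gcongr; linarith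
      _ = Real.exp (n * L) := by
        rw [Real.exp_nat_mul, hLdef, Real.exp_log (by linarith)]
      _ ≤ _ := Real.exp_le_exp.mpr (by linarith)

lemma typical_lower {A B : Type*} [Fintype A] [Fintype B] [Nonempty A] {n : ℕ} (hn : 0 < n)
    (p : Fin n → A × B → ℝ) (hp : ∀ j w, 0 ≤ p j w) (h1 : ∀ j, ∑ w, p j w = 1)
    (ε : ℝ) (hε : 0 < ε) (hε1 : ε < 1) (Δ : ℝ)
    (hΔ : Δ = Real.sqrt (2 * n) * Real.log ((Fintype.card A : ℝ) + 3)
      * Real.sqrt (Real.logb 2 (1 / ε))) :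
    ∃ G : (Fin n → A) → (Fin n → B) → Prop,
      (∑ a : Fin n → A, ∑ b : Fin n → B, (if G a b then 0 else ∏ j, p j (a j, b j))) ≤ ε ∧
      ∀ a b, G a b → ∏ j, p j (a j, b j) ≤ (∏ j, ∑ a', p j (a', b j))
        * Real.exp (Δ - ∑ j, Real.log 2 * condEnt (p j)) := by
  have hk : (1 : ℝ) ≤ Fintype.card A := by exact_mod_cast Fintype.card_pos
  set L := Real.log ((Fintype.card A : ℝ) + 3) with hLdef
  have hL : 0 < L := Real.log_pos (by linarith)
  set H := ∑ j, Real.log 2 * condEnt (p j) with hH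
  have hR0 : ∀ b : Fin n → B, 0 ≤ ∏ j, ∑ a', p j (a', b j) := fun b =>
    Finset.prod_nonneg fun j _ => Finset.sum_nonneg fun i _ => hp j _
  by_cases hle : Δ ≤ n * L
  · obtain ⟨hs0, hs1, hs2⟩ := delta_calc hn L ε hL hε hε1 Δ _ hΔ rfl hle
    set s := Real.log 2 * Δ / (n * L ^ 2)
    refine ⟨fun a b => ∏ j, p j (a j, b j) = 0 ∨
      H - Δ ≤ ∑ j, Real.log (invCond (p j) (a j, b j)), ?_, ?_⟩
    · rw [← hs2]
      refine chernoff p hp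
        (fun j w => (-s) * (Real.log (invCond (p j) w) - Real.log 2 * condEnt (p j)))
        _ _ (fun j => mgf_down (p j) (hp j) (h1 j) s hs0 hs1) _ ?_
      intro a b hb hz
      have hb' : ∑ j, Real.log (invCond (p j) (a j, b j)) < H - Δ := by
        by_contra hc
        exact hb (Or.inr (not_lt.mp hc))
      rw [← Finset.mul_sum, Finset.sum_sub_distrib]
      have := mul_le_mul_of_nonneg_left hb'.le hs0
      linarith
    · rintro a b hG
      by_cases hz : ∏ j, p j (a j, b j) = 0
      · rw [hz]; exact mul_nonneg (hR0 b) (Real.exp_pos _).le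
      · have hG' := hG.resolve_left hz
        rw [prod_eq_invCond p hp a b hz]
        apply mul_le_mul_of_nonneg_left _ (hR0 b)
        exact Real.exp_le_exp.mpr (by linarith)
  · push Not at hle
    refine ⟨fun _ _ => True, by simpa using hε.le, ?_⟩
    intro a b _
    have hHle : H ≤ n * L := by
      calc H ≤ ∑ _j : Fin n, L := Finset.sum_le_sum fun j _ => ent_le (p j) (hp j) (h1 j)
        _ = n * L := by simp
    calc ∏ j, p j (a j, b j) ≤ ∏ j, ∑ a', p j (a', b j) := by
          apply Finset.prod_le_prod
          · intro j _; exact hp j _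
          · intro j _
            exact Finset.single_le_sum (f := fun a' => p j (a', b j)) (fun i _ => hp j _)
              (Finset.mem_univ (a j))
      _ ≤ _ := le_mul_of_one_le_right (hR0 b) (Real.one_le_exp (by linarith))

lemma coll_count {A K : Type*} [Fintype A] [Fintype K] [Nonempty K] (x x' : A) (hx : x ≠ x') :
    ∑ f : A → K, (if f x = f x' then (1 : ℝ) else 0)
      = (Fintype.card (A → K) : ℝ) / Fintype.card K := by
  have hκ : (Fintype.card K : ℝ) ≠ 0 := by exact_mod_cast Fintype.card_ne_zero
  rw [Fintype.card_congr (Equiv.funSplitAt x K), Fintype.card_prod]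
  push_cast
  rw [mul_div_cancel_left₀ _ hκ]
  rw [← (Equiv.funSplitAt x K).symm.sum_comp, Fintype.sum_prod_type, Finset.sum_comm]
  have : ∀ (k : K) (f : {j // j ≠ x} → K),
      (if (Equiv.funSplitAt x K).symm (k, f) x = (Equiv.funSplitAt x K).symm (k, f) x'
        then (1 : ℝ) else 0) = if k = f ⟨x', hx.symm⟩ then 1 else 0 := by
    intro k f
    simp [Equiv.funSplitAt, Equiv.piSplitAt, hx.symm]
  simp only [this]
  simp

lemma W_sum {A K : Type*} [Fintype A] [Fintype K] [Nonempty K] (x x' : A) :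
    ∑ f : A → K, ∑ k : K, ((if f x = k then (1 : ℝ) else 0) - 1 / Fintype.card K)
        * ((if f x' = k then (1 : ℝ) else 0) - 1 / Fintype.card K)
      ≤ if x = x' then (Fintype.card (A → K) : ℝ) else 0 := by
  have hκ : (0 : ℝ) < Fintype.card K := by exact_mod_cast Fintype.card_pos
  have h1 : ∀ f : A → K, ∑ k : K, ((if f x = k then (1 : ℝ) else 0) - 1 / Fintype.card K)
        * ((if f x' = k then (1 : ℝ) else 0) - 1 / Fintype.card K)
      = (if f x = f x' then (1 : ℝ) else 0) - 1 / Fintype.card K := by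
    intro f
    simp only [sub_mul, mul_sub, Finset.sum_sub_distrib, ite_mul, mul_ite, one_mul, zero_mul,
      mul_zero, mul_one, Finset.sum_ite_eq, Finset.mem_univ, if_true, Finset.sum_const,
      Finset.card_univ, nsmul_eq_mul]
    field_simp
    ring
  simp only [h1, Finset.sum_sub_distrib]
  split_ifs with h
  · subst h
    simp only [if_true, Finset.sum_const, nsmul_eq_mul, mul_one, Finset.card_univ]
    have : 0 ≤ (Fintype.card (A → K) : ℝ) * (1 / Fintype.card K) := by positivity
    linarith
  · rw [coll_count x x' h]
    simp only [Finset.sum_const, nsmul_eq_mul, Finset.card_univ]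
    apply le_of_eq
    ring

lemma W_sum_ne {A K : Type*} [Fintype A] [Fintype K] [Nonempty K] (r : A → ℝ) (hr : ∀ x, 0 ≤ r x) :
    ∑ f : A → K, ∑ k : K, (∑ x, r x * ((if f x = k then (1 : ℝ) else 0) - 1 / Fintype.card K)) ^ 2
      ≤ (Fintype.card (A → K) : ℝ) * ∑ x, r x ^ 2 := by
  have e : ∑ f : A → K, ∑ k : K,
        (∑ x, r x * ((if f x = k then (1 : ℝ) else 0) - 1 / Fintype.card K)) ^ 2
      = ∑ x, ∑ x', (r x * r x') * ∑ f : A → K, ∑ k : K,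
        ((if f x = k then (1 : ℝ) else 0) - 1 / Fintype.card K)
        * ((if f x' = k then (1 : ℝ) else 0) - 1 / Fintype.card K) := by
    simp only [pow_two, Finset.sum_mul_sum]
    simp only [Finset.mul_sum]
    calc _ = ∑ f : A → K, ∑ x, ∑ x', ∑ k : K, _ := by
          apply Finset.sum_congr rfl; intro f _
          rw [Finset.sum_comm]
          apply Finset.sum_congr rfl; intro x _
          rw [Finset.sum_comm]
      _ = _ := by
          rw [Finset.sum_comm]
          apply Finset.sum_congr rfl; intro x _
          rw [Finset.sum_comm]
          apply Finset.sum_congr rfl; intro x' _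
          apply Finset.sum_congr rfl; intro f _
          apply Finset.sum_congr rfl; intro k _
          ring
  rw [e]
  calc _ ≤ ∑ x, ∑ x', (r x * r x') * (if x = x' then (Fintype.card (A → K) : ℝ) else 0) := by
        apply Finset.sum_le_sum; intro x _
        apply Finset.sum_le_sum; intro x' _
        exact mul_le_mul_of_nonneg_left (W_sum x x') (mul_nonneg (hr x) (hr x'))
    _ = _ := by
        simp only [mul_ite, mul_zero, Finset.sum_ite_eq, Finset.mem_univ, if_true]
        rw [Finset.mul_sum]
        apply Finset.sum_congr rfl; intro x _
        ring

/-- Deviation of the hashed distribution from uniform. -/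
noncomputable def Dev {A K C : Type*} [Fintype A] [Fintype K] (h : A → C) (q : A → ℝ)
    (f : A → K) (k : K) (c : C) : ℝ :=
  ∑ x, (if h x = c then q x else 0) * ((if f x = k then (1 : ℝ) else 0) - 1 / Fintype.card K)

lemma dev_good {A K C : Type*} [Fintype A] [Fintype K] [Nonempty K] [Fintype C] (h : A → C)
    (E : Finset C) (hE : ∀ x, h x ∈ E) (q : A → ℝ) (hq : ∀ x, 0 ≤ q x) :
    ∑ f : A → K, ∑ k : K, ∑ c, |Dev h q f k c|
      ≤ (Fintype.card (A → K) : ℝ) * Real.sqrt (Fintype.card K * E.card * ∑ x, q x ^ 2) := by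
  have e1 : ∑ f : A → K, ∑ k : K, ∑ c, |Dev h q f k c|
      = ∑ v ∈ (Finset.univ : Finset ((A → K) × K)) ×ˢ E, |Dev h q v.1.1 v.1.2 v.2| := by
    rw [Finset.sum_product, Fintype.sum_prod_type]
    apply Finset.sum_congr rfl; intro f _
    apply Finset.sum_congr rfl; intro k _
    symm
    apply Finset.sum_subset (Finset.subset_univ _)
    intro c _ hc
    unfold Dev
    rw [Finset.sum_eq_zero]
    · simp
    · intro x _
      have : h x ≠ c := fun hh => hc (hh ▸ hE x)
      simp [this]
  have e2 : ∑ v ∈ (Finset.univ : Finset ((A → K) × K)) ×ˢ E, |Dev h q v.1.1 v.1.2 v.2| ^ 2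
      ≤ (Fintype.card (A → K) : ℝ) * ∑ x, q x ^ 2 := by
    rw [Finset.sum_product_right]
    calc _ ≤ ∑ c ∈ E, (Fintype.card (A → K) : ℝ) * ∑ x, (if h x = c then q x else 0) ^ 2 := by
          apply Finset.sum_le_sum; intro c _
          rw [Fintype.sum_prod_type]
          simp only [sq_abs]
          exact W_sum_ne (K := K) (fun x => if h x = c then q x else 0)
            (fun x => by split_ifs; exacts [hq x, le_rfl])
      _ = _ := by
          rw [← Finset.mul_sum, Finset.sum_comm]
          congr 1
          apply Finset.sum_congr rfl; intro x _
          have : ∀ c, (if h x = c then q x else 0) ^ 2 = if h x = c then q x ^ 2 else 0 := by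
            intro c; split_ifs <;> simp
          simp only [this, Finset.sum_ite_eq, hE x, if_true]
  rw [e1]
  have cs := sq_sum_le_card_mul_sum_sq
    (s := (Finset.univ : Finset ((A → K) × K)) ×ˢ E) (f := fun v => |Dev h q v.1.1 v.1.2 v.2|)
  have hc : (((Finset.univ : Finset ((A → K) × K)) ×ˢ E).card : ℝ)
      = Fintype.card (A → K) * Fintype.card K * E.card := by
    rw [Finset.card_product, Finset.card_univ, Fintype.card_prod]; push_cast; ring
  rw [hc] at cs
  set F := (Fintype.card (A → K) : ℝ)
  have hF : 0 ≤ F := by positivity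
  have : ∀ X Y : ℝ, 0 ≤ X → X ^ 2 ≤ F ^ 2 * Y → X ≤ F * Real.sqrt Y := by
    intro X Y hX hXY
    have h1 := Real.sqrt_le_sqrt hXY
    rwa [Real.sqrt_sq hX, Real.sqrt_mul (sq_nonneg F), Real.sqrt_sq hF] at h1
  apply this
  · exact Finset.sum_nonneg fun v _ => abs_nonneg _
  · refine cs.trans ?_
    calc _ ≤ F * Fintype.card K * E.card * (F * ∑ x, q x ^ 2) := by gcongr
      _ = _ := by ring

lemma dev_bad {A K C : Type*} [Fintype A] [Fintype K] [Nonempty K] [Fintype C] (h : A → C)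
    (q : A → ℝ) (hq : ∀ x, 0 ≤ q x) :
    ∑ f : A → K, ∑ k : K, ∑ c, |Dev h q f k c|
      ≤ (Fintype.card (A → K) : ℝ) * (2 * ∑ x, q x) := by
  have hκ : (0 : ℝ) < Fintype.card K := by exact_mod_cast Fintype.card_pos
  have : ∀ f : A → K, ∑ k : K, ∑ c, |Dev h q f k c| ≤ 2 * ∑ x, q x := by
    intro f
    calc _ ≤ ∑ k : K, ∑ c, ∑ x, (if h x = c then q x else 0)
            * ((if f x = k then (1 : ℝ) else 0) + 1 / Fintype.card K) := by
          apply Finset.sum_le_sum; intro k _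
          apply Finset.sum_le_sum; intro c _
          unfold Dev
          refine (Finset.abs_sum_le_sum_abs _ _).trans ?_
          apply Finset.sum_le_sum; intro x _
          have h0 : 0 ≤ (if h x = c then q x else 0) := by split_ifs; exacts [hq x, le_rfl]
          rw [abs_mul, abs_of_nonneg h0]
          apply mul_le_mul_of_nonneg_left _ h0
          refine (abs_sub _ _).trans ?_
          rw [abs_of_nonneg (by positivity : (0 : ℝ) ≤ 1 / Fintype.card K),
            abs_of_nonneg (by split_ifs <;> norm_num)]
      _ = ∑ x, ∑ k : K, ∑ c, (if h x = c then q x else 0)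
            * ((if f x = k then (1 : ℝ) else 0) + 1 / Fintype.card K) := by
          rw [Finset.sum_comm]
          rw [Finset.sum_congr rfl (fun c _ => Finset.sum_comm), Finset.sum_comm]
          apply Finset.sum_congr rfl; intro x _
          rw [Finset.sum_comm]
      _ = 2 * ∑ x, q x := by
          rw [Finset.mul_sum]
          apply Finset.sum_congr rfl; intro x _
          simp only [← Finset.sum_mul, Finset.sum_ite_eq, Finset.mem_univ, if_true]
          rw [← Finset.mul_sum, Finset.sum_add_distrib]
          simp only [Finset.sum_ite_eq, Finset.mem_univ, if_true, Finset.sum_const,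
            Finset.card_univ, nsmul_eq_mul]
          field_simp
          ring
  calc _ ≤ ∑ _f : A → K, 2 * ∑ x, q x := Finset.sum_le_sum fun f _ => this f
    _ = _ := by rw [Finset.sum_const, nsmul_eq_mul, Finset.card_univ]

lemma lhl {A K C Z : Type*} [Fintype A] [Fintype K] [Nonempty K] [Fintype C] [Fintype Z]
    (h : A → C) (E : Finset C) (hE : ∀ x, h x ∈ E) (Q : A → Z → ℝ) (hQ : ∀ x z, 0 ≤ Q x z)
    (R : Z → ℝ) (hR : ∀ z, ∑ x, Q x z = R z) (hR1 : ∑ z, R z = 1)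
    (G : A → Z → Prop) (lam δ : ℝ) (hlam : 0 ≤ lam) (hG : ∀ x z, G x z → Q x z ≤ R z * lam)
    (hb : ∑ x, ∑ z, (if G x z then 0 else Q x z) ≤ δ) :
    ∑ f : A → K, ∑ k : K, ∑ c, ∑ z, |Dev h (fun x => Q x z) f k c|
      ≤ (Fintype.card (A → K) : ℝ)
        * (2 * δ + Real.sqrt (Fintype.card K * E.card * lam)) := by
  have hR0 : ∀ z, 0 ≤ R z := fun z => by rw [← hR]; exact Finset.sum_nonneg fun x _ => hQ x z
  set F := (Fintype.card (A → K) : ℝ)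
  have hF : 0 ≤ F := by positivity
  have hz : ∀ z, ∑ f : A → K, ∑ k : K, ∑ c, |Dev h (fun x => Q x z) f k c|
      ≤ F * (2 * ∑ x, (if G x z then 0 else Q x z))
        + F * (R z * Real.sqrt (Fintype.card K * E.card * lam)) := by
    intro z
    have hq0 : ∀ x, 0 ≤ (if G x z then Q x z else 0) := fun x => by
      split_ifs; exacts [hQ x z, le_rfl]
    have hb0 : ∀ x, 0 ≤ (if G x z then 0 else Q x z) := fun x => by
      split_ifs; exacts [le_rfl, hQ x z]
    have g1 := dev_good (K := K) h E hE (fun x => if G x z then Q x z else 0) hq0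
    have g2 := dev_bad (K := K) h (fun x => if G x z then 0 else Q x z) hb0
    have g3 : ∑ x, (if G x z then Q x z else 0) ^ 2 ≤ R z ^ 2 * lam := by
      calc _ ≤ ∑ x, Q x z * (R z * lam) := by
            apply Finset.sum_le_sum; intro x _
            split_ifs with hg
            · rw [pow_two]; exact mul_le_mul_of_nonneg_left (hG x z hg) (hQ x z)
            · have := mul_nonneg (hQ x z) (mul_nonneg (hR0 z) hlam)
              simpa using this
        _ = _ := by rw [← Finset.sum_mul, hR]; ring
    have g4 : Real.sqrt (Fintype.card K * E.card * ∑ x, (if G x z then Q x z else 0) ^ 2)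
        ≤ R z * Real.sqrt (Fintype.card K * E.card * lam) := by
      calc _ ≤ Real.sqrt (R z ^ 2 * (Fintype.card K * E.card * lam)) := by
            apply Real.sqrt_le_sqrt
            calc _ ≤ (Fintype.card K * E.card : ℝ) * (R z ^ 2 * lam) := by gcongr
              _ = _ := by ring
        _ = _ := by rw [Real.sqrt_mul (sq_nonneg _), Real.sqrt_sq (hR0 z)]
    have g5 := mul_le_mul_of_nonneg_left g4 hF
    have g6 : ∑ f : A → K, ∑ k : K, ∑ c, |Dev h (fun x => Q x z) f k c|
        ≤ ∑ f : A → K, ∑ k : K, ∑ c, |Dev h (fun x => if G x z then 0 else Q x z) f k c|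
        + ∑ f : A → K, ∑ k : K, ∑ c, |Dev h (fun x => if G x z then Q x z else 0) f k c| := by
      simp only [← Finset.sum_add_distrib]
      apply Finset.sum_le_sum; intro f _
      apply Finset.sum_le_sum; intro k _
      apply Finset.sum_le_sum; intro c _
      refine le_trans (le_of_eq ?_) (abs_add_le _ _)
      congr 1
      unfold Dev
      rw [← Finset.sum_add_distrib]
      apply Finset.sum_congr rfl; intro x _
      by_cases hGx : G x z <;> simp [hGx]
    linarith
  calc _ = ∑ z, ∑ f : A → K, ∑ k : K, ∑ c, |Dev h (fun x => Q x z) f k c| := by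
        rw [Finset.sum_comm (s := (Finset.univ : Finset Z))]
        apply Finset.sum_congr rfl; intro f _
        rw [Finset.sum_comm (s := (Finset.univ : Finset Z))]
        apply Finset.sum_congr rfl; intro k _
        rw [Finset.sum_comm]
    _ ≤ ∑ z, (F * (2 * ∑ x, (if G x z then 0 else Q x z))
        + F * (R z * Real.sqrt (Fintype.card K * E.card * lam))) :=
        Finset.sum_le_sum fun z _ => hz z
    _ = F * (2 * ∑ x, ∑ z, (if G x z then 0 else Q x z)
        + Real.sqrt (Fintype.card K * E.card * lam)) := by
        rw [Finset.sum_add_distrib, ← Finset.mul_sum, ← Finset.mul_sum, ← Finset.mul_sum,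
          ← Finset.sum_mul, hR1, Finset.sum_comm]
        ring
    _ ≤ _ := by gcongr

lemma binning {A B : Type*} [Fintype A] [Fintype B] [Nonempty A] (Q : A → B → ℝ)
    (hQ : ∀ a b, 0 ≤ Q a b) (hQ1 : ∑ a, ∑ b, Q a b = 1) (T : A → B → Prop) (N ε₁ ε₂ : ℝ)
    (hε₂ : 0 ≤ ε₂)
    (hN : ∀ b, ((Finset.univ.filter (fun a => T a b)).card : ℝ) ≤ N)
    (M : ℕ) (hM : 0 < M) (hMN : N - 1 ≤ ε₂ * M)
    (hb : ∑ a, ∑ b, (if T a b then 0 else Q a b) ≤ ε₁) :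
    ∃ (h : A → Fin M) (g : Fin M → B → A),
      ∑ a, ∑ b, (if g (h a) b = a then 0 else Q a b) ≤ ε₁ + ε₂ := by
  have : Nonempty (Fin M) := ⟨⟨0, hM⟩⟩
  have hM' : (0 : ℝ) < M := by exact_mod_cast hM
  have hg : ∀ h : A → Fin M, ∃ g : Fin M → B → A,
      ∀ c b, (∃ a, T a b ∧ h a = c) → T (g c b) b ∧ h (g c b) = c := by
    intro h
    refine ⟨fun c b => if H : ∃ a, T a b ∧ h a = c then H.choose else Classical.arbitrary A, ?_⟩
    intro c b H
    simp only [H, dif_pos]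
    exact H.choose_spec
  choose g hg using hg
  set F := (Fintype.card (A → Fin M) : ℝ)
  have hF : 0 ≤ F := by positivity
  have hpt : ∀ (h : A → Fin M) a b, (if g h (h a) b = a then 0 else Q a b)
      ≤ (if T a b then 0 else Q a b)
        + (if T a b then Q a b * ∑ a' ∈ (Finset.univ.filter (fun a' => T a' b)).erase a,
            (if h a = h a' then (1 : ℝ) else 0) else 0) := by
    intro h a b
    have hnn : 0 ≤ ∑ a' ∈ (Finset.univ.filter (fun a' => T a' b)).erase a,
            (if h a = h a' then (1 : ℝ) else 0) :=
      Finset.sum_nonneg fun _ _ => by split_ifs <;> norm_num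
    by_cases hT : T a b
    · simp only [hT, if_true, zero_add]
      split_ifs with he
      · exact mul_nonneg (hQ a b) hnn
      · obtain ⟨k1, k2⟩ := hg h (h a) b ⟨a, hT, rfl⟩
        have : (1 : ℝ) ≤ ∑ a' ∈ (Finset.univ.filter (fun a' => T a' b)).erase a,
            (if h a = h a' then (1 : ℝ) else 0) := by
          have hs := Finset.single_le_sum (s := (Finset.univ.filter (fun a' => T a' b)).erase a)
            (f := fun a' => (if h a = h a' then (1 : ℝ) else 0))
            (fun _ _ => by split_ifs <;> norm_num)
            (a := g h (h a) b) (by simp [he, k1])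
          simpa [k2] using hs
        exact le_mul_of_one_le_right (hQ a b) this
    · simp only [hT, if_false, add_zero]
      split_ifs
      · exact hQ a b
      · exact le_rfl
  have key : ∑ h : A → Fin M, ∑ a, ∑ b, (if g h (h a) b = a then 0 else Q a b)
      ≤ ∑ _h : A → Fin M, (ε₁ + ε₂) := by
    calc _ ≤ ∑ h : A → Fin M, ∑ a, ∑ b, ((if T a b then 0 else Q a b)
        + (if T a b then Q a b * ∑ a' ∈ (Finset.univ.filter (fun a' => T a' b)).erase a,
            (if h a = h a' then (1 : ℝ) else 0) else 0)) :=
          Finset.sum_le_sum fun h _ => Finset.sum_le_sum fun a _ =>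
            Finset.sum_le_sum fun b _ => hpt h a b
      _ = F * (∑ a, ∑ b, (if T a b then 0 else Q a b)) + ∑ a, ∑ b,
          (if T a b then Q a b * ∑ a' ∈ (Finset.univ.filter (fun a' => T a' b)).erase a,
            ∑ h : A → Fin M, (if h a = h a' then (1 : ℝ) else 0) else 0) := by
          simp only [Finset.sum_add_distrib, Finset.sum_const, nsmul_eq_mul, Finset.card_univ]
          congr 1
          rw [Finset.sum_comm]
          apply Finset.sum_congr rfl; intro a _
          rw [Finset.sum_comm]
          apply Finset.sum_congr rfl; intro b _
          split_ifs
          · rw [← Finset.mul_sum, Finset.sum_comm]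
          · simp
      _ ≤ F * ε₁ + ∑ a, ∑ b, Q a b * (F * ε₂) := by
          apply add_le_add (mul_le_mul_of_nonneg_left hb hF)
          apply Finset.sum_le_sum; intro a _
          apply Finset.sum_le_sum; intro b _
          split_ifs with hT
          · apply mul_le_mul_of_nonneg_left _ (hQ a b)
            have hmem : a ∈ Finset.univ.filter (fun a' => T a' b) := by simp [hT]
            calc _ = ∑ a' ∈ (Finset.univ.filter (fun a' => T a' b)).erase a, F / M := by
                  apply Finset.sum_congr rfl
                  intro a' ha'
                  have hcc := coll_count (K := Fin M) a a' (Finset.ne_of_mem_erase ha').symm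
                  rw [Fintype.card_fin] at hcc
                  convert hcc
              _ = (((Finset.univ.filter (fun a' => T a' b)).card : ℝ) - 1) * (F / M) := by
                  rw [Finset.sum_const, nsmul_eq_mul, Finset.card_erase_of_mem hmem,
                    Nat.cast_sub (Finset.card_pos.mpr ⟨a, hmem⟩)]
                  simp
              _ ≤ (ε₂ * M) * (F / M) := by
                  apply mul_le_mul_of_nonneg_right _ (by positivity)
                  linarith [hN b]
              _ = F * ε₂ := by field_simp
          · have := hQ a b
            positivity
      _ = _ := by
          simp only [← Finset.sum_mul]
          rw [hQ1, Finset.sum_const, nsmul_eq_mul, Finset.card_univ]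
          ring
  obtain ⟨h, -, hh⟩ := Finset.exists_le_of_sum_le Finset.univ_nonempty key
  exact ⟨h, g h, hh⟩

lemma final_arith (ℓ M : ℕ) (Hz Hy Dz Dy ε₂ σ ε' N lam : ℝ) (hε₂ : 0 < ε₂) (hε'σ : ε' < σ / 2)
    (hε' : 0 < ε')
    (hN : N = Real.exp (Hy + Dy)) (hlam : lam = Real.exp (Dz - Hz)) (hM : (M : ℝ) ≤ N / ε₂)
    (hℓ : (ℓ : ℝ) * Real.log 2 ≤ Hz - Hy + 2 * Real.log 2
      + Real.log (ε₂ * (σ - 2 * ε') ^ 2) - (Dz + Dy)) :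
    2 * ε' + Real.sqrt ((2 : ℝ) ^ ℓ * M * lam) ≤ 2 * σ := by
  have hd : 0 < σ - 2 * ε' := by linarith
  have h2 : (2 : ℝ) ^ ℓ = Real.exp (ℓ * Real.log 2) := by
    rw [Real.exp_nat_mul, Real.exp_log (by norm_num)]
  have h4 : Real.exp (2 * Real.log 2) = 4 := by
    have := Real.exp_nat_mul (Real.log 2) 2
    rw [Real.exp_log (by norm_num)] at this
    push_cast at this
    rw [this]; norm_num
  have key : (2 : ℝ) ^ ℓ * M * lam ≤ (2 * (σ - 2 * ε')) ^ 2 := by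
    calc (2 : ℝ) ^ ℓ * M * lam ≤ (2 : ℝ) ^ ℓ * (N / ε₂) * lam := by
          have : 0 ≤ lam := by rw [hlam]; positivity
          gcongr
      _ = Real.exp (ℓ * Real.log 2 + (Hy + Dy) + (Dz - Hz)) / ε₂ := by
          rw [h2, hN, hlam, Real.exp_add (_ + _), Real.exp_add (_ * _)]; ring
      _ ≤ Real.exp (2 * Real.log 2 + Real.log (ε₂ * (σ - 2 * ε') ^ 2)) / ε₂ := by
          apply div_le_div_of_nonneg_right _ hε₂.le
          exact Real.exp_le_exp.mpr (by linarith)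
      _ = _ := by
          rw [Real.exp_add, Real.exp_log (by positivity), h4]
          field_simp
          ring
  have := Real.sqrt_le_sqrt key
  rw [Real.sqrt_sq (by linarith)] at this
  linarith

/-- Theorem 2, inequality (9): for independent (not necessarily
identical) pairs and any `0 < ε, σ < 1`, splitting `ε = ε₁ + ε₂` and taking
`ε' < σ/2`, there is a one-message protocol (seed sets, hash families for
reconciliation and extraction, and a decoder for Bob) producing an
`(ε,σ)`-secret key of any length
`ℓ ≤ H(X^n|Z^n) − H(X^n|Y^n) + 2 + log₂(ε₂(σ−2ε')²)
    − √(2n)·log₂(|X|+3)·(√(log₂(1/ε')) + √(log₂(1/ε₁)))`. -/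
theorem omska_achievable_key_length
    {𝒳 𝒴 𝒵 : Type*} [Fintype 𝒳] [Fintype 𝒴] [Fintype 𝒵] [Nonempty 𝒳]
    (n : ℕ) (hn : 0 < n)
    (P : Fin n → 𝒳 × 𝒴 × 𝒵 → ℝ)
    (hP : ∀ j, (∀ w, 0 ≤ P j w) ∧ ∑ w, P j w = 1)
    (ε σ ε₁ ε₂ ε' : ℝ)
    (hε : 0 < ε) (hε1 : ε < 1) (hσ : 0 < σ) (hσ1 : σ < 1)
    (hε₁ : 0 < ε₁) (hε₂ : 0 < ε₂) (hsum : ε₁ + ε₂ = ε)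
    (hε'pos : 0 < ε') (hε'σ : ε' < σ / 2)
    (ℓ : ℕ)
    (hℓ : (ℓ : ℝ) ≤ (∑ j, condEnt (margXZ (P j))) - (∑ j, condEnt (margXY (P j)))
        + 2 + Real.logb 2 (ε₂ * (σ - 2 * ε') ^ 2)
        - Real.sqrt (2 * n) * Real.logb 2 ((Fintype.card 𝒳 : ℝ) + 3)
          * (Real.sqrt (Real.logb 2 (1 / ε')) + Real.sqrt (Real.logb 2 (1 / ε₁)))) :
    ∃ (m m' t : ℕ) (_ : 0 < m) (_ : 0 < m')
      (h : Fin m → (Fin n → 𝒳) → (Fin t → Bool))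
      (h' : Fin m' → (Fin n → 𝒳) → (Fin ℓ → Bool))
      (g : (Fin t → Bool) → (Fin n → 𝒴) → (Fin n → 𝒳)),
      -- reliability: Pr[K_A ≠ K_B] ≤ ε
      (∑ v ∈ Finset.univ.filter
          (fun v : (Fin m × Fin m') ×
              ((Fin n → 𝒳) × (Fin n → 𝒴) × (Fin n → 𝒵)) =>
            h' v.1.2 (g (h v.1.1 v.2.1) v.2.2.1) ≠ h' v.1.2 v.2.1),
        (∏ j, P j (v.2.1 j, v.2.2.1 j, v.2.2.2 j)) / ((m : ℝ) * (m' : ℝ)))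
        ≤ ε
      ∧
      -- secrecy: SD((K, h_S(X^n), S', S, Z^n); (U_ℓ, h_S(X^n), S', S, Z^n)) ≤ σ
      SD
        (fun w : (Fin ℓ → Bool) × (Fin t → Bool) × Fin m' × Fin m × (Fin n → 𝒵) =>
          (∑ xy ∈ Finset.univ.filter
              (fun xy : (Fin n → 𝒳) × (Fin n → 𝒴) =>
                h' w.2.2.1 xy.1 = w.1 ∧ h w.2.2.2.1 xy.1 = w.2.1),
            ∏ j, P j (xy.1 j, xy.2 j, w.2.2.2.2 j))
            / ((m : ℝ) * (m' : ℝ)))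
        (fun w : (Fin ℓ → Bool) × (Fin t → Bool) × Fin m' × Fin m × (Fin n → 𝒵) =>
          (∑ xy ∈ Finset.univ.filter
              (fun xy : (Fin n → 𝒳) × (Fin n → 𝒴) => h w.2.2.2.1 xy.1 = w.2.1),
            ∏ j, P j (xy.1 j, xy.2 j, w.2.2.2.2 j))
            / ((m : ℝ) * (m' : ℝ) * 2 ^ ℓ))
        ≤ σ := by
  have hl2 : 0 < Real.log 2 := Real.log_pos (by norm_num)
  have hε₁1 : ε₁ < 1 := by linarith
  have hε₂1 : ε₂ < 1 := by linarith
  have hε'1 : ε' < 1 := by linarith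
  have hk : (1 : ℝ) ≤ Fintype.card 𝒳 := by exact_mod_cast Fintype.card_pos
  -- marginals
  have hy0 : ∀ j w, 0 ≤ margXY (P j) w := fun j w => Finset.sum_nonneg fun z _ => (hP j).1 _
  have hz0 : ∀ j w, 0 ≤ margXZ (P j) w := fun j w => Finset.sum_nonneg fun z _ => (hP j).1 _
  have hy1 : ∀ j, ∑ w, margXY (P j) w = 1 := by
    intro j
    rw [← (hP j).2]
    simp only [margXY, Fintype.sum_prod_type]
  have hz1 : ∀ j, ∑ w, margXZ (P j) w = 1 := by
    intro j
    rw [← (hP j).2]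
    simp only [margXZ, Fintype.sum_prod_type]
    apply Finset.sum_congr rfl; intro x _
    rw [Finset.sum_comm]
  have hQy : ∀ (x : Fin n → 𝒳) (y : Fin n → 𝒴),
      ∑ z : Fin n → 𝒵, ∏ j, P j (x j, y j, z j) = ∏ j, margXY (P j) (x j, y j) := by
    intro x y
    simp only [margXY]
    rw [Fintype.prod_sum]
  have hQz : ∀ (x : Fin n → 𝒳) (z : Fin n → 𝒵),
      ∑ y : Fin n → 𝒴, ∏ j, P j (x j, y j, z j) = ∏ j, margXZ (P j) (x j, z j) := by
    intro x z
    simp only [margXZ]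
    rw [Fintype.prod_sum]
  obtain ⟨T, hT1, hT2⟩ := typical_upper hn (fun j => margXY (P j)) hy0 hy1 ε₁ hε₁ hε₁1 _ rfl
  obtain ⟨G, hG1, hG2⟩ := typical_lower hn (fun j => margXZ (P j)) hz0 hz1 ε' hε'pos hε'1 _ rfl
  set Dy := Real.sqrt (2 * n) * Real.log ((Fintype.card 𝒳 : ℝ) + 3)
      * Real.sqrt (Real.logb 2 (1 / ε₁)) with hDy
  set Dz := Real.sqrt (2 * n) * Real.log ((Fintype.card 𝒳 : ℝ) + 3)
      * Real.sqrt (Real.logb 2 (1 / ε')) with hDz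
  set Hy := ∑ j, Real.log 2 * condEnt (margXY (P j)) with hHy
  set Hz := ∑ j, Real.log 2 * condEnt (margXZ (P j)) with hHz
  obtain ⟨N, hN⟩ : ∃ N, N = Real.exp (Hy + Dy) := ⟨_, rfl⟩
  obtain ⟨lam, hlam⟩ : ∃ lam, lam = Real.exp (Dz - Hz) := ⟨_, rfl⟩
  rw [← hN] at hT2
  rw [← hlam] at hG2
  have hN1 : 1 ≤ N := by
    rw [hN]
    apply Real.one_le_exp
    have h1 : 0 ≤ Hy := Finset.sum_nonneg fun j _ => ent_nonneg _ (hy0 j)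
    have h2 : 0 ≤ Dy := by
      have : 0 ≤ Real.log ((Fintype.card 𝒳 : ℝ) + 3) := Real.log_nonneg (by linarith)
      positivity
    linarith
  obtain ⟨M, hMdef⟩ : ∃ M, M = ⌊N / ε₂⌋₊ := ⟨_, rfl⟩
  have hMle : (M : ℝ) ≤ N / ε₂ := by rw [hMdef]; exact Nat.floor_le (by positivity)
  have hM : 0 < M := by
    rw [hMdef]
    apply Nat.floor_pos.mpr
    rw [le_div_iff₀ hε₂]; linarith
  have hMN : N - 1 ≤ ε₂ * M := by
    have h1 : N / ε₂ < M + 1 := by rw [hMdef]; exact Nat.lt_floor_add_one _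
    rw [div_lt_iff₀ hε₂] at h1
    linarith
  have hQy1 : ∑ x : Fin n → 𝒳, ∑ y : Fin n → 𝒴, ∏ j, margXY (P j) (x j, y j) = 1 := by
    rw [prod_pair_sum (fun j => margXY (P j))]
    simp [hy1]
  obtain ⟨h0, g0, hg0⟩ := binning (fun (x : Fin n → 𝒳) (y : Fin n → 𝒴) =>
    ∏ j, margXY (P j) (x j, y j)) (fun x y => Finset.prod_nonneg fun j _ => hy0 j _) hQy1
    T N ε₁ ε₂ hε₂.le hT2 M hM hMN hT1
  have : Nonempty (Fin M) := ⟨⟨0, hM⟩⟩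
  obtain ⟨enc, henc⟩ : ∃ enc : Fin M → (Fin M → Bool), Function.Injective enc := by
    refine ⟨fun i j => decide (i = j), ?_⟩
    intro i i' hi
    have := congrFun hi i'
    simpa using this
  obtain ⟨m', e⟩ : ∃ m', Nonempty (Fin m' ≃ ((Fin n → 𝒳) → (Fin ℓ → Bool))) :=
    ⟨_, ⟨(Fintype.equivFin _).symm⟩⟩
  obtain ⟨e⟩ := e
  have hm'c : Fintype.card ((Fin n → 𝒳) → (Fin ℓ → Bool)) = m' := by
    rw [← Fintype.card_congr e, Fintype.card_fin]
  have hm' : 0 < m' := by rw [← hm'c]; exact Fintype.card_pos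
  have hm'R : (0 : ℝ) < m' := by exact_mod_cast hm'
  refine ⟨1, m', M, one_pos, hm', fun _ x => enc (h0 x), fun s => e s,
    fun c y => g0 (Function.invFun enc c) y, ?_, ?_⟩
  · rw [Finset.sum_filter]
    simp only [Function.leftInverse_invFun henc _]
    calc _ ≤ ∑ v : (Fin 1 × Fin m') × ((Fin n → 𝒳) × (Fin n → 𝒴) × (Fin n → 𝒵)),
          (if g0 (h0 v.2.1) v.2.2.1 = v.2.1 then 0
            else ∏ j, P j (v.2.1 j, v.2.2.1 j, v.2.2.2 j)) / (m' : ℝ) := by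
          apply Finset.sum_le_sum
          intro v _
          have hW : 0 ≤ ∏ j, P j (v.2.1 j, v.2.2.1 j, v.2.2.2 j) :=
            Finset.prod_nonneg fun j _ => (hP j).1 _
          by_cases hv : g0 (h0 v.2.1) v.2.2.1 = v.2.1
          · simp [hv]
          · simp only [hv, if_false, Nat.cast_one, one_mul]
            split_ifs
            · exact le_rfl
            · positivity
      _ = ∑ x : Fin n → 𝒳, ∑ y : Fin n → 𝒴,
          (if g0 (h0 x) y = x then 0 else ∏ j, margXY (P j) (x j, y j)) := by
          rw [Fintype.sum_prod_type]
          simp only [Finset.sum_const, Finset.card_univ, nsmul_eq_mul, Fintype.card_prod,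
            Fintype.card_fin, one_mul]
          rw [← Finset.sum_div, mul_div_cancel₀ _ hm'R.ne']
          rw [Fintype.sum_prod_type]
          apply Finset.sum_congr rfl; intro x _
          rw [Fintype.sum_prod_type]
          apply Finset.sum_congr rfl; intro y _
          dsimp only
          split_ifs
          · simp
          · exact hQy x y
      _ ≤ ε := by rw [← hsum]; convert hg0
  · have hlhl0 := lhl (K := Fin ℓ → Bool) (fun x => enc (h0 x)) (Finset.univ.image enc)
      (fun x => Finset.mem_image_of_mem _ (Finset.mem_univ _))
      (fun (x : Fin n → 𝒳) (z : Fin n → 𝒵) => ∏ j, margXZ (P j) (x j, z j))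
      (fun x z => Finset.prod_nonneg fun j _ => hz0 j _)
      (fun z => ∏ j, ∑ a', margXZ (P j) (a', z j))
      (fun z => by rw [Fintype.prod_sum])
      (by
        rw [← Fintype.prod_sum (fun j (b : 𝒵) => ∑ a', margXZ (P j) (a', b))]
        apply Finset.prod_eq_one
        intro j _
        rw [Finset.sum_comm, ← Fintype.sum_prod_type (f := fun w => margXZ (P j) w), hz1 j])
      G lam ε' (by rw [hlam]; positivity) hG2 hG1
    rw [Finset.card_image_of_injective _ henc, Finset.card_univ, Fintype.card_fin] at hlhl0
    have hcK : (Fintype.card (Fin ℓ → Bool) : ℝ) = 2 ^ ℓ := by simp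
    have hlhl : (∑ f : (Fin n → 𝒳) → (Fin ℓ → Bool), ∑ k, ∑ c, ∑ z : Fin n → 𝒵,
          |Dev (fun x => enc (h0 x)) (fun x : Fin n → 𝒳 => ∏ j, margXZ (P j) (x j, z j)) f k c|)
        ≤ (m' : ℝ) * (2 * ε' + Real.sqrt ((2 : ℝ) ^ ℓ * M * lam)) := by
      rw [← hcK, ← hm'c]
      convert hlhl0
    have hfin := final_arith ℓ M Hz Hy Dz Dy ε₂ σ ε' N lam hε₂ hε'σ hε'pos hN hlam hMle (by
      have := mul_le_mul_of_nonneg_right hℓ hl2.le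
      refine this.trans (le_of_eq ?_)
      rw [hHz, hHy, hDz, hDy, ← Finset.mul_sum, ← Finset.mul_sum]
      unfold Real.logb
      field_simp)
    unfold SD
    have hpt : ∀ (k : Fin ℓ → Bool) (c : Fin M → Bool) (s : Fin m') (z : Fin n → 𝒵),
        |(∑ xy ∈ Finset.univ.filter
              (fun xy : (Fin n → 𝒳) × (Fin n → 𝒴) => e s xy.1 = k ∧ enc (h0 xy.1) = c),
            ∏ j, P j (xy.1 j, xy.2 j, z j)) / (((1 : ℕ) : ℝ) * (m' : ℝ))
          - (∑ xy ∈ Finset.univ.filter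
              (fun xy : (Fin n → 𝒳) × (Fin n → 𝒴) => enc (h0 xy.1) = c),
            ∏ j, P j (xy.1 j, xy.2 j, z j)) / (((1 : ℕ) : ℝ) * (m' : ℝ) * 2 ^ ℓ)|
        = |Dev (fun x => enc (h0 x)) (fun x : Fin n → 𝒳 => ∏ j, margXZ (P j) (x j, z j)) (e s) k c|
          / m' := by
      intro k c s z
      have e1 : ∑ xy ∈ Finset.univ.filter
              (fun xy : (Fin n → 𝒳) × (Fin n → 𝒴) => e s xy.1 = k ∧ enc (h0 xy.1) = c),
            ∏ j, P j (xy.1 j, xy.2 j, z j)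
          = ∑ x : Fin n → 𝒳, (if enc (h0 x) = c then ∏ j, margXZ (P j) (x j, z j) else 0)
            * (if e s x = k then (1 : ℝ) else 0) := by
        rw [Finset.sum_filter, Fintype.sum_prod_type]
        apply Finset.sum_congr rfl; intro x _
        dsimp only
        by_cases h1 : e s x = k <;> by_cases h2 : enc (h0 x) = c <;> simp [h1, h2, hQz]
      have e2 : ∑ xy ∈ Finset.univ.filter
              (fun xy : (Fin n → 𝒳) × (Fin n → 𝒴) => enc (h0 xy.1) = c),
            ∏ j, P j (xy.1 j, xy.2 j, z j)
          = ∑ x : Fin n → 𝒳, (if enc (h0 x) = c then ∏ j, margXZ (P j) (x j, z j) else 0) := by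
        rw [Finset.sum_filter, Fintype.sum_prod_type]
        apply Finset.sum_congr rfl; intro x _
        dsimp only
        by_cases h2 : enc (h0 x) = c <;> simp [h2, hQz]
      have e3 : Dev (fun x => enc (h0 x)) (fun x : Fin n → 𝒳 => ∏ j, margXZ (P j) (x j, z j))
          (e s) k c = (∑ x : Fin n → 𝒳,
            (if enc (h0 x) = c then ∏ j, margXZ (P j) (x j, z j) else 0)
            * (if e s x = k then (1 : ℝ) else 0))
          - (∑ x : Fin n → 𝒳, (if enc (h0 x) = c then ∏ j, margXZ (P j) (x j, z j) else 0))
            * (1 / 2 ^ ℓ) := by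
        unfold Dev
        rw [hcK, Finset.sum_mul, ← Finset.sum_sub_distrib]
        apply Finset.sum_congr rfl; intro x _
        rw [mul_sub]
        congr!
      rw [e1, e2, e3]
      rw [show ∀ X : ℝ, |X| / (m' : ℝ) = |X / m'| from fun X => by rw [abs_div, abs_of_pos hm'R]]
      congr 1
      push_cast
      field_simp
    have hsumeq : ∑ w : (Fin ℓ → Bool) × (Fin M → Bool) × Fin m' × Fin 1 × (Fin n → 𝒵),
        |Dev (fun x => enc (h0 x)) (fun x : Fin n → 𝒳 => ∏ j, margXZ (P j) (x j, w.2.2.2.2 j))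
          (e w.2.2.1) w.1 w.2.1| / m'
        = (∑ f : (Fin n → 𝒳) → (Fin ℓ → Bool), ∑ k, ∑ c, ∑ z : Fin n → 𝒵,
          |Dev (fun x => enc (h0 x)) (fun x : Fin n → 𝒳 => ∏ j, margXZ (P j) (x j, z j)) f k c|)
          / m' := by
      rw [← Finset.sum_div]
      congr 1
      simp only [Fintype.sum_prod_type, Finset.univ_unique, Finset.sum_singleton]
      rw [← e.sum_comp]
      rw [Finset.sum_comm' (s := (Finset.univ : Finset (Fin m'))) (t := fun _ => Finset.univ)
          (t' := Finset.univ) (s' := fun _ => Finset.univ) (by simp)]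
      apply Finset.sum_congr rfl; intro k _
      rw [Finset.sum_comm]
    have hfinal : (∑ f : (Fin n → 𝒳) → (Fin ℓ → Bool), ∑ k, ∑ c, ∑ z : Fin n → 𝒵,
          |Dev (fun x => enc (h0 x)) (fun x : Fin n → 𝒳 => ∏ j, margXZ (P j) (x j, z j)) f k c|)
          / m' ≤ 2 * σ := by
      rw [div_le_iff₀ hm'R]
      refine hlhl.trans ?_
      rw [mul_comm]
      gcongr
    rw [← hsumeq] at hfinal
    have hgoal := Finset.sum_congr (rfl : (Finset.univ : Finset ((Fin ℓ → Bool) × (Fin M → Bool)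
      × Fin m' × Fin 1 × (Fin n → 𝒵))) = Finset.univ)
      (fun w _ => hpt w.1 w.2.1 w.2.2.1 w.2.2.2.2)
    rw [← hgoal] at hfinal
    have h2 : (1 / 2 : ℝ) * (2 * σ) = σ := by ring
    refine le_trans (mul_le_mul_of_nonneg_left ?_ (by norm_num : (0 : ℝ) ≤ 1 / 2)) h2.le
    convert hfinal
end

section
/- For IID sources, the maximum one-way secret key length satisfies the second-order lower bound S^{ow}_{ε,σ}(X^n, Y^n | Z^n) ≥ n(H(X|Z) − H(X|Y)) − √n·(Q^{-1}(ε)√(Δ_{X|Y}) + Q^{-1}(σ/2)√(Δ_{X|Z})) − (3/2)log₂ n + O(1), where Δ_{U|V} = Var(−log₂ P_{U|V}(U|V)). -/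
open scoped Classical

/-- Conditional information variance `Δ_{A|B} = Var(−log₂ P_{A|B}(A|B))`. -/
noncomputable def condVar {A B : Type*} [Fintype A] [Fintype B] (P : A × B → ℝ) : ℝ :=
  ∑ w : A × B, P w * (- Real.logb 2 (condProb P w.1 w.2) - condEnt P) ^ 2

/-- Standard Gaussian tail function `Q(α) = Pr[N(0,1) > α]`. -/
noncomputable def Qtail (α : ℝ) : ℝ :=
  ∫ x in Set.Ioi α, Real.exp (-x ^ 2 / 2) / Real.sqrt (2 * Real.pi)

section CLTPart
open MeasureTheory ProbabilityTheory Filter Topology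

lemma Qtail_eq_setIntegral (t : ℝ) :
    Qtail t = ∫ x in Set.Ioi t, gaussianPDFReal 0 1 x := by
  unfold Qtail
  congr 1
  ext x
  simp [gaussianPDFReal]
  ring

lemma Qtail_eq_gaussian (t : ℝ) :
    ENNReal.ofReal (Qtail t) = gaussianReal 0 1 (Set.Ioi t) := by
  rw [gaussianReal_apply_eq_integral 0 one_ne_zero, Qtail_eq_setIntegral]

lemma Qtail_nonneg (t : ℝ) : 0 ≤ Qtail t := by
  rw [Qtail_eq_setIntegral]
  exact integral_nonneg fun x => gaussianPDFReal_nonneg 0 1 x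

lemma Qtail_sub (a b : ℝ) (hab : a ≤ b) :
    Qtail a = Qtail b + ∫ x in a..b, gaussianPDFReal 0 1 x := by
  rw [Qtail_eq_setIntegral, Qtail_eq_setIntegral, intervalIntegral.integral_of_le hab,
    add_comm, ← setIntegral_union]
  · rw [Set.Ioc_union_Ioi_eq_Ioi hab]
  · exact Set.Ioc_disjoint_Ioi le_rfl
  · exact measurableSet_Ioi
  · exact (integrable_gaussianPDFReal 0 1).integrableOn
  · exact (integrable_gaussianPDFReal 0 1).integrableOn

lemma Qtail_lt (a b : ℝ) (hab : a < b) : Qtail b < Qtail a := by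
  rw [Qtail_sub a b hab.le]
  have : 0 < ∫ x in a..b, gaussianPDFReal 0 1 x := by
    apply intervalIntegral.intervalIntegral_pos_of_pos
    · exact (integrable_gaussianPDFReal 0 1).intervalIntegrable
    · intro x; exact gaussianPDFReal_pos 0 1 x one_ne_zero
    · exact hab
  linarith

lemma Qtail_le_add (a b : ℝ) (hab : a ≤ b) : Qtail a ≤ Qtail b + (b - a) := by
  rw [Qtail_sub a b hab]
  have h : ‖∫ x in a..b, gaussianPDFReal 0 1 x‖ ≤ 1 * |b - a| := by
    apply intervalIntegral.norm_integral_le_of_norm_le_const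
    intro x _
    rw [Real.norm_of_nonneg (gaussianPDFReal_nonneg 0 1 x)]
    unfold gaussianPDFReal
    have h1 : (√(2 * Real.pi * ((1 : NNReal) : ℝ)))⁻¹ ≤ 1 := by
      apply inv_le_one_of_one_le₀
      rw [Real.one_le_sqrt]
      have := Real.pi_gt_three
      simp; linarith
    have h2 : Real.exp (-(x - 0) ^ 2 / (2 * ((1 : NNReal) : ℝ))) ≤ 1 := by
      rw [Real.exp_le_one_iff]
      have := sq_nonneg (x - 0)
      exact div_nonpos_of_nonpos_of_nonneg (by linarith) (by simp)
    have h3 : 0 ≤ (√(2 * Real.pi * ((1 : NNReal) : ℝ)))⁻¹ := by positivity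
    calc _ ≤ (1 : ℝ) * 1 := mul_le_mul h1 h2 (Real.exp_nonneg _) zero_le_one
      _ = 1 := one_mul 1
  rw [Real.norm_eq_abs, abs_of_nonneg (sub_nonneg.2 hab)] at h
  have := le_abs_self (∫ x in a..b, gaussianPDFReal 0 1 x)
  linarith

lemma clt_unit {Ω : Type*} [Fintype Ω] (p : Ω → ℝ) (hp0 : ∀ w, 0 ≤ p w) (hp1 : ∑ w, p w = 1)
    (g : Ω → ℝ) (hg0 : ∑ w, p w * g w = 0) (hg1 : ∑ w, p w * g w ^ 2 = 1) (t : ℝ) :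
    Tendsto (fun n : ℕ => ∑ x ∈ Finset.univ.filter
      (fun x : Fin n → Ω => t < (√(n : ℝ))⁻¹ * ∑ j, g (x j)), ∏ j, p (x j))
      atTop (𝓝 (Qtail t)) := by
  let _ : MeasurableSpace Ω := ⊤
  have : MeasurableSingletonClass Ω := ⟨fun _ => trivial⟩
  have hsum : ∑ w, ENNReal.ofReal (p w) = 1 := by
    rw [← ENNReal.ofReal_sum_of_nonneg (fun i _ => hp0 i), hp1, ENNReal.ofReal_one]
  let q : PMF Ω := PMF.ofFintype (fun w => ENNReal.ofReal (p w)) hsum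
  let μ : Measure Ω := q.toMeasure
  have hμs : ∀ w, μ {w} = ENNReal.ofReal (p w) := by
    intro w
    rw [PMF.toMeasure_apply_singleton q w trivial]
    rfl
  let Pm : Measure (ℕ → Ω) := Measure.infinitePi (fun _ => μ)
  let X : ℕ → (ℕ → Ω) → ℝ := fun k ω => g (ω k)
  have hgm : Measurable g := measurable_from_top
  have hmp : ∀ k, MeasurePreserving (Function.eval k) Pm μ := fun k =>
    measurePreserving_eval_infinitePi (fun _ => μ) k
  have hint : ∀ h : Ω → ℝ, ∫ ω, h (ω 0) ∂Pm = ∑ w, p w * h w := by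
    intro h
    have h1 : ∫ ω, h (ω 0) ∂Pm = ∫ w, h w ∂μ := by
      rw [← (hmp 0).map_eq, integral_map (hmp 0).measurable.aemeasurable
        (measurable_from_top (f := h)).aestronglyMeasurable]
    rw [h1, integral_fintype (Integrable.of_finite)]
    apply Finset.sum_congr rfl
    intro w _
    rw [Measure.real, hμs, ENNReal.toReal_ofReal (hp0 w), smul_eq_mul]
  have hindep : iIndepFun X Pm :=
    iIndepFun_infinitePi (P := fun _ : ℕ => μ) (X := fun _ : ℕ => g) (fun _ => hgm)
  have hident : ∀ i, IdentDistrib (X i) (X 0) Pm Pm := by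
    intro i
    refine ⟨(hgm.comp (hmp i).measurable).aemeasurable, (hgm.comp (hmp 0).measurable).aemeasurable, ?_⟩
    have : ∀ i, Measure.map (X i) Pm = Measure.map g μ := by
      intro i
      rw [← (hmp i).map_eq, Measure.map_map hgm (hmp i).measurable]
      rfl
    rw [this, this]
  have hY : HasLaw (id : ℝ → ℝ) (gaussianReal 0 1) (gaussianReal 0 1) := HasLaw.id
  have h0 : Pm[X 0] = 0 := (hint g).trans hg0
  have h1 : Pm[X 0 ^ 2] = 1 := (hint (fun w => g w ^ 2)).trans hg1
  have key := (tendstoInDistribution_inv_sqrt_mul_sum hY h0 h1 hindep hident)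
  have hk := ProbabilityMeasure.tendsto_measure_of_null_frontier_of_tendsto' key.tendsto
    (E := Set.Ioi t) (by
      have := nullSingletonClass_gaussianReal (μ := 0) (v := 1) one_ne_zero
      simp)
  simp only [ProbabilityMeasure.coe_mk, Measure.map_id] at hk
  rw [← Qtail_eq_gaussian] at hk
  have hk2 := (ENNReal.tendsto_toReal ENNReal.ofReal_ne_top).comp hk
  rw [ENNReal.toReal_ofReal (Qtail_nonneg t)] at hk2
  refine hk2.congr ?_
  intro n
  simp only [Function.comp_apply]
  let r : (ℕ → Ω) → (Fin n → Ω) := fun ω i => ω i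
  have hr : Measurable r := by
    apply measurable_pi_lambda
    intro i
    exact measurable_pi_apply _
  have hmap : Measure.map r Pm = Measure.pi (fun _ : Fin n => μ) := by
    rw [← Measure.infinitePi_eq_pi]
    exact Measure.map_infinitePi_infinitePi_of_inj (P := fun _ : ℕ => μ) (f := fun i : Fin n => (i : ℕ))
      Fin.val_injective
  let E : Finset (Fin n → Ω) := Finset.univ.filter
      (fun x : Fin n → Ω => t < (√(n : ℝ))⁻¹ * ∑ j, g (x j))
  have hmeas : Measurable (fun ω => (√(n : ℝ))⁻¹ * ∑ k ∈ Finset.range n, X k ω) := by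
    apply Measurable.const_mul
    apply Finset.measurable_fun_sum
    intro k _
    exact hgm.comp (hmp k).measurable
  have hset : Measure.map (fun ω => (√(n : ℝ))⁻¹ * ∑ k ∈ Finset.range n, X k ω) Pm (Set.Ioi t)
      = Measure.pi (fun _ : Fin n => μ) (E : Set (Fin n → Ω)) := by
    rw [← hmap, Measure.map_apply hmeas measurableSet_Ioi,
      Measure.map_apply hr (Finset.measurableSet E)]
    congr 1
    ext ω
    simp [E, r, X, Finset.sum_range]
  rw [hset, ← sum_measure_singleton, ENNReal.toReal_sum (by
    intro a _; exact measure_ne_top _ _)]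
  apply Finset.sum_congr rfl
  intro x _
  rw [Measure.pi_singleton]
  simp only [hμs]
  rw [← ENNReal.ofReal_prod_of_nonneg (fun i _ => hp0 _), ENNReal.toReal_ofReal
    (Finset.prod_nonneg fun i _ => hp0 _)]

lemma clt_fin {Ω : Type*} [Fintype Ω] (p : Ω → ℝ) (hp0 : ∀ w, 0 ≤ p w) (hp1 : ∑ w, p w = 1)
    (g : Ω → ℝ) (hg0 : ∑ w, p w * g w = 0) (v : ℝ) (hv : 0 < v)
    (hg1 : ∑ w, p w * g w ^ 2 = v) (t : ℝ) :
    Tendsto (fun n : ℕ => ∑ x ∈ Finset.univ.filter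
      (fun x : Fin n → Ω => √(n : ℝ) * (t * √v) < ∑ j, g (x j)), ∏ j, p (x j))
      atTop (𝓝 (Qtail t)) := by
  have hs : 0 < √v := Real.sqrt_pos.2 hv
  have := clt_unit p hp0 hp1 (fun w => g w / √v) (by
    simp_rw [← mul_div_assoc]; rw [← Finset.sum_div, hg0, zero_div]) (by
    simp_rw [div_pow, Real.sq_sqrt hv.le, ← mul_div_assoc]
    rw [← Finset.sum_div, hg1, div_self hv.ne']) t
  refine this.congr' ?_
  filter_upwards [eventually_gt_atTop 0] with n hn
  congr 1
  ext x
  simp only [Finset.mem_filter, Finset.mem_univ, true_and]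
  have hn' : 0 < √(n : ℝ) := Real.sqrt_pos.2 (by exact_mod_cast hn)
  rw [← Finset.sum_div, inv_mul_eq_div, lt_div_iff₀ hn', lt_div_iff₀ hs]
  constructor <;> intro h <;> linarith
end CLTPart

section OneShot

lemma sum_fun_one {A R : Type*} [Fintype A] [Fintype R] (a : A) (k : R → ℝ) :
    (∑ s : A → R, k (s a)) * (Fintype.card R : ℝ) = (Fintype.card (A → R) : ℝ) * ∑ r, k r := by
  have h1 : ∀ k : R → ℝ, ∑ s : A → R, k (s a)
      = (Fintype.card ({j // j ≠ a} → R) : ℝ) * ∑ r, k r := by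
    intro k
    rw [← (Equiv.funSplitAt a R).symm.sum_comp, Fintype.sum_prod_type, Finset.mul_sum]
    apply Finset.sum_congr rfl
    intro r _
    simp [Equiv.funSplitAt]
  have h2 := h1 (fun _ => 1)
  simp only [Finset.sum_const, Finset.card_univ, nsmul_eq_mul, mul_one] at h2
  rw [h1, h2]; ring

lemma sum_fun_two {A R : Type*} [Fintype A] [Fintype R] (a a' : A) (haa : a' ≠ a)
    (h : R → R → ℝ) :
    (∑ s : A → R, h (s a) (s a')) * ((Fintype.card R : ℝ) * Fintype.card R)
      = (Fintype.card (A → R) : ℝ) * ∑ r, ∑ r', h r r' := by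
  have h1 : ∀ h : R → R → ℝ, (∑ s : A → R, h (s a) (s a')) * (Fintype.card R : ℝ)
      = (Fintype.card ({j // j ≠ a} → R) : ℝ) * ∑ r, ∑ r', h r r' := by
    intro h
    rw [← (Equiv.funSplitAt a R).symm.sum_comp, Fintype.sum_prod_type, Finset.mul_sum,
      Finset.sum_mul]
    apply Finset.sum_congr rfl
    intro r _
    have := sum_fun_one (A := {j // j ≠ a}) (⟨a', haa⟩ : {j // j ≠ a}) (h r)
    have hL : ∑ y : {j // j ≠ a} → R, h ((Equiv.funSplitAt a R).symm (r, y) a)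
        ((Equiv.funSplitAt a R).symm (r, y) a') = ∑ s : {j // j ≠ a} → R, h r (s ⟨a', haa⟩) := by
      simp [Equiv.funSplitAt, haa]
    rw [hL]
    convert this
  have h2 := sum_fun_one a (fun _ : R => (1 : ℝ))
  have h3 := h1 (fun _ _ => 1)
  simp only [Finset.sum_const, Finset.card_univ, nsmul_eq_mul, mul_one] at h2 h3
  rcases Nat.eq_zero_or_pos (Fintype.card R) with h0 | h0
  · have : IsEmpty R := Fintype.card_eq_zero_iff.1 h0
    simp
  · have h0' : (0 : ℝ) < Fintype.card R := by exact_mod_cast h0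
    have h4 : (Fintype.card (A → R) : ℝ)
        = (Fintype.card ({j // j ≠ a} → R) : ℝ) * Fintype.card R := by
      apply mul_right_cancel₀ h0'.ne'
      rw [h3]; ring
    rw [← mul_assoc, h1, h4]; ring

/-- signed deviation kernel -/
noncomputable def devK (M ℓ : ℕ) (r r' : Fin M × (Fin ℓ → Bool)) : ℝ :=
  (if r = r' then 1 else 0) - (if r.1 = r'.1 then 1 else 0) / 2 ^ ℓ

lemma sum_ind_fst (M ℓ : ℕ) (c : Fin M) :
    ∑ r : Fin M × (Fin ℓ → Bool), (if c = r.1 then (1 : ℝ) else 0) / 2 ^ ℓ = 1 := by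
  rw [Fintype.sum_prod_type]
  have h : ∀ x : Fin M, ∑ _y : Fin ℓ → Bool, (if c = x then (1 : ℝ) else 0) / 2 ^ ℓ
      = if c = x then (1 : ℝ) else 0 := by
    intro x
    rw [Finset.sum_const, Finset.card_univ, nsmul_eq_mul]
    have : (Fintype.card (Fin ℓ → Bool) : ℝ) = 2 ^ ℓ := by simp
    rw [this]
    field_simp
  rw [Finset.sum_congr rfl fun x _ => h x]
  simp

lemma sum_abs_devK (M ℓ : ℕ) (r : Fin M × (Fin ℓ → Bool)) : ∑ r', |devK M ℓ r r'| ≤ 2 := by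
  have hb : ∀ r', |devK M ℓ r r'| ≤ (if r = r' then 1 else 0) + (if r.1 = r'.1 then 1 else 0) / 2 ^ ℓ := by
    intro r'
    unfold devK
    refine (abs_sub _ _).trans (le_of_eq ?_)
    congr 1 <;> apply abs_of_nonneg
    · split_ifs <;> simp
    · apply div_nonneg
      · split_ifs <;> simp
      · positivity
  refine (Finset.sum_le_sum fun r' _ => hb r').trans ?_
  rw [Finset.sum_add_distrib, sum_ind_fst]
  simp
  norm_num

lemma sum_devK (M ℓ : ℕ) (r' : Fin M × (Fin ℓ → Bool)) : ∑ r, devK M ℓ r r' = 0 := by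
  unfold devK
  rw [Finset.sum_sub_distrib]
  have h := sum_ind_fst M ℓ r'.1
  simp_rw [eq_comm (a := r'.1)] at h
  rw [h]
  simp

lemma abs_devK_le (M ℓ : ℕ) (r r' : Fin M × (Fin ℓ → Bool)) : |devK M ℓ r r'| ≤ 1 := by
  unfold devK
  have h1 : (1 : ℝ) ≤ 2 ^ ℓ := one_le_pow₀ (by norm_num)
  have h2 : 1 / (2 : ℝ) ^ ℓ ≤ 1 := by rw [div_le_one (by positivity)]; exact h1
  have h3 : 0 ≤ 1 / (2 : ℝ) ^ ℓ := by positivity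
  by_cases h : r = r'
  · subst h
    simp only [if_true]
    rw [abs_le]; constructor <;> linarith
  · rw [if_neg h]
    split_ifs
    · rw [abs_le]; constructor <;> linarith
    · simp

lemma sum_sq_devK (M ℓ : ℕ) (r : Fin M × (Fin ℓ → Bool)) : ∑ r', devK M ℓ r r' ^ 2 ≤ 2 := by
  refine le_trans (Finset.sum_le_sum fun r' _ => ?_) (sum_abs_devK M ℓ r)
  rw [← sq_abs]
  have h1 := abs_devK_le M ℓ r r'
  have h0 := abs_nonneg (devK M ℓ r r')
  nlinarith

/-- second moment bound over random functions -/
lemma second_moment {A : Type*} [Fintype A] (M ℓ : ℕ) (hM : 0 < M) (g : A → ℝ) :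
    ∑ s : A → Fin M × (Fin ℓ → Bool), ∑ r, (∑ a, g a * devK M ℓ (s a) r) ^ 2
      ≤ 2 * (Fintype.card (A → Fin M × (Fin ℓ → Bool)) : ℝ) * ∑ a, g a ^ 2 := by
  have e1 : ∑ s : A → Fin M × (Fin ℓ → Bool), ∑ r, (∑ a, g a * devK M ℓ (s a) r) ^ 2
      = ∑ a, ∑ a', g a * g a' * ∑ s : A → Fin M × (Fin ℓ → Bool), ∑ r,
          devK M ℓ (s a) r * devK M ℓ (s a') r := by
    simp_rw [sq, Finset.sum_mul_sum, Finset.mul_sum]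
    rw [Finset.sum_congr rfl fun s _ => Finset.sum_comm, Finset.sum_comm]
    refine Finset.sum_congr rfl fun a _ => ?_
    rw [Finset.sum_congr rfl fun s _ => Finset.sum_comm, Finset.sum_comm]
    refine Finset.sum_congr rfl fun a' _ => ?_
    refine Finset.sum_congr rfl fun s _ => Finset.sum_congr rfl fun r _ => ?_
    ring
  rw [e1, Finset.mul_sum]
  apply Finset.sum_le_sum
  intro a _
  rw [Finset.sum_eq_single a]
  · have : ∑ s : A → Fin M × (Fin ℓ → Bool), ∑ r, devK M ℓ (s a) r * devK M ℓ (s a) r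
        ≤ ∑ s : A → Fin M × (Fin ℓ → Bool), 2 := by
      apply Finset.sum_le_sum
      intro s _
      simp_rw [← sq]
      exact sum_sq_devK M ℓ (s a)
    rw [Finset.sum_const, Finset.card_univ, nsmul_eq_mul] at this
    have h0 : 0 ≤ g a * g a := mul_self_nonneg _
    calc _ ≤ g a * g a * ((Fintype.card (A → Fin M × (Fin ℓ → Bool)) : ℝ) * 2) :=
          mul_le_mul_of_nonneg_left this h0
      _ = _ := by ring
  · intro a' _ haa
    have h2 := sum_fun_two a a' haa (fun r1 r2 => ∑ r, devK M ℓ r1 r * devK M ℓ r2 r)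
    have h3 : ∑ r1, ∑ r2, ∑ r, devK M ℓ r1 r * devK M ℓ r2 r = 0 := by
      apply Finset.sum_eq_zero
      intro r1 _
      rw [Finset.sum_comm]
      apply Finset.sum_eq_zero
      intro r _
      rw [← Finset.mul_sum, sum_devK, mul_zero]
    rw [h3, mul_zero] at h2
    have hR : (0 : ℝ) < Fintype.card (Fin M × (Fin ℓ → Bool)) := by
      have : Nonempty (Fin M) := ⟨⟨0, hM⟩⟩
      exact_mod_cast Fintype.card_pos
    have h4 := (mul_eq_zero.1 h2).resolve_right (mul_pos hR hR).ne'
    rw [h4, mul_zero]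
  · simp

/-- first moment bound over random functions (leftover hash lemma) -/
lemma first_moment {A : Type*} [Fintype A] (M ℓ : ℕ) (hM : 0 < M) (g : A → ℝ)
    (B : ℝ) (hB : 0 ≤ B) (hg : ∑ a, g a ^ 2 ≤ B ^ 2) :
    ∑ s : A → Fin M × (Fin ℓ → Bool), ∑ r, |∑ a, g a * devK M ℓ (s a) r|
      ≤ (Fintype.card (A → Fin M × (Fin ℓ → Bool)) : ℝ) * (B * √(2 * (M * 2 ^ ℓ))) := by
  have h2 := second_moment M ℓ hM g
  set m : ℝ := (Fintype.card (A → Fin M × (Fin ℓ → Bool)) : ℝ) with hm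
  have hm0 : 0 ≤ m := by positivity
  apply le_of_sq_le_sq _ (by positivity)
  rw [← Fintype.sum_prod_type']
  refine (sq_sum_le_card_mul_sum_sq).trans ?_
  simp_rw [sq_abs]
  rw [Fintype.sum_prod_type (fun x : (A → Fin M × (Fin ℓ → Bool)) × (Fin M × (Fin ℓ → Bool)) =>
    (∑ a, g a * devK M ℓ (x.1 a) x.2) ^ 2)]
  rw [mul_pow, mul_pow, Real.sq_sqrt (by positivity)]
  have hc : ((Finset.univ : Finset ((A → Fin M × (Fin ℓ → Bool)) × (Fin M × (Fin ℓ → Bool)))).card : ℝ)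
      = m * (M * 2 ^ ℓ) := by
    rw [Finset.card_univ, Fintype.card_prod, Nat.cast_mul, ← hm]
    simp
  rw [hc]
  calc _ ≤ m * (M * 2 ^ ℓ) * (2 * m * B ^ 2) := by
        apply mul_le_mul_of_nonneg_left _ (by positivity)
        exact h2.trans (mul_le_mul_of_nonneg_left hg (by positivity))
    _ = _ := by ring

end OneShot

section Protocol

lemma sum_coll {A : Type*} [Fintype A] (M ℓ : ℕ) (hM : 0 < M) (a a' : A) (haa : a' ≠ a) :
    ∑ s : A → Fin M × (Fin ℓ → Bool), (if (s a).1 = (s a').1 then (1 : ℝ) else 0)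
      = (Fintype.card (A → Fin M × (Fin ℓ → Bool)) : ℝ) / M := by
  have h := sum_fun_two a a' haa (fun r r' : Fin M × (Fin ℓ → Bool) =>
    if r.1 = r'.1 then (1 : ℝ) else 0)
  have h2 : ∀ r : Fin M × (Fin ℓ → Bool), ∑ r' : Fin M × (Fin ℓ → Bool),
      (if r.1 = r'.1 then (1 : ℝ) else 0) = 2 ^ ℓ := by
    intro r
    have := sum_ind_fst M ℓ r.1
    rw [← Finset.sum_div, div_eq_one_iff_eq (by positivity)] at this
    exact this
  have hR : (Fintype.card (Fin M × (Fin ℓ → Bool)) : ℝ) = M * 2 ^ ℓ := by simp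
  rw [Finset.sum_congr rfl fun r _ => h2 r, Finset.sum_const, Finset.card_univ, nsmul_eq_mul,
    hR] at h
  have hM' : (0 : ℝ) < M := by exact_mod_cast hM
  have h2l : (0 : ℝ) < 2 ^ ℓ := by positivity
  rw [eq_div_iff hM'.ne']
  have hz : ((M : ℝ) * 2 ^ ℓ * 2 ^ ℓ) ≠ 0 := by positivity
  apply mul_right_cancel₀ hz
  linarith

/-- decoder -/
noncomputable def decK {A B : Type*} (M ℓ : ℕ) (q : A → B → ℝ) (Λ : ℝ)
    (s : A → Fin M × (Fin ℓ → Bool)) (c : Fin M) (b : B) : Fin ℓ → Bool :=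
  if h : ∃ a, (s a).1 = c ∧ 1 / Λ ≤ q a b then (s h.choose).2 else fun _ => false

lemma decK_err {A B : Type*} [Fintype A] (M ℓ : ℕ) (q : A → B → ℝ) (Λ : ℝ)
    (s : A → Fin M × (Fin ℓ → Bool)) (a : A) (b : B) :
    (if decK M ℓ q Λ s (s a).1 b ≠ (s a).2 then (1 : ℝ) else 0)
      ≤ (if q a b < 1 / Λ then (1 : ℝ) else 0)
        + ∑ a', (if a' ≠ a ∧ 1 / Λ ≤ q a' b then (if (s a).1 = (s a').1 then (1 : ℝ) else 0) else 0) := by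
  have hnn : ∀ a' ∈ (Finset.univ : Finset A), 0 ≤
      (if a' ≠ a ∧ 1 / Λ ≤ q a' b then (if (s a).1 = (s a').1 then (1 : ℝ) else 0) else 0) := by
    intro a' _
    split_ifs <;> simp
  have hsn := Finset.sum_nonneg hnn
  by_cases herr : decK M ℓ q Λ s (s a).1 b ≠ (s a).2
  · rw [if_pos herr]
    by_cases ht : q a b < 1 / Λ
    · rw [if_pos ht]; linarith
    · rw [if_neg ht, zero_add]
      have hex : ∃ a', (s a').1 = (s a).1 ∧ 1 / Λ ≤ q a' b := ⟨a, rfl, not_lt.1 ht⟩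
      have hne : hex.choose ≠ a := by
        intro h
        apply herr
        unfold decK
        rw [dif_pos hex, h]
      have hle := Finset.single_le_sum hnn (Finset.mem_univ hex.choose)
      rw [if_pos ⟨hne, hex.choose_spec.2⟩, if_pos hex.choose_spec.1.symm] at hle
      exact hle
  · rw [if_neg herr]
    have : (0 : ℝ) ≤ (if q a b < 1 / Λ then (1 : ℝ) else 0) := by split_ifs <;> simp
    linarith

lemma rel_bound {A B C : Type*} [Fintype A] [Fintype B] [Fintype C]
    (p : A × B × C → ℝ) (hp0 : ∀ v, 0 ≤ p v) (hp1 : ∑ v, p v = 1)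
    (q : A → B → ℝ) (hq0 : ∀ a b, 0 ≤ q a b) (hq1 : ∀ b, ∑ a, q a b ≤ 1)
    (Λ : ℝ) (hΛ : 0 < Λ) (M ℓ : ℕ) (hM : 0 < M) :
    ∑ s : A → Fin M × (Fin ℓ → Bool), ∑ v : A × B × C,
      (if decK M ℓ q Λ s (s v.1).1 v.2.1 ≠ (s v.1).2 then (1 : ℝ) else 0) * p v
    ≤ (Fintype.card (A → Fin M × (Fin ℓ → Bool)) : ℝ) *
      ((∑ v : A × B × C, (if q v.1 v.2.1 < 1 / Λ then (1 : ℝ) else 0) * p v) + Λ / M) := by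
  set m : ℝ := (Fintype.card (A → Fin M × (Fin ℓ → Bool)) : ℝ) with hm
  have hm0 : 0 ≤ m := by positivity
  have hM' : (0 : ℝ) < M := by exact_mod_cast hM
  have hv : ∀ v : A × B × C, ∑ s : A → Fin M × (Fin ℓ → Bool),
      (if decK M ℓ q Λ s (s v.1).1 v.2.1 ≠ (s v.1).2 then (1 : ℝ) else 0)
      ≤ m * ((if q v.1 v.2.1 < 1 / Λ then (1 : ℝ) else 0) + Λ / M) := by
    intro v
    refine (Finset.sum_le_sum fun s _ => decK_err M ℓ q Λ s v.1 v.2.1).trans ?_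
    rw [Finset.sum_add_distrib, Finset.sum_const, Finset.card_univ, nsmul_eq_mul, ← hm, mul_add]
    apply add_le_add le_rfl
    rw [Finset.sum_comm]
    have : ∀ a' : A, ∑ s : A → Fin M × (Fin ℓ → Bool),
        (if a' ≠ v.1 ∧ 1 / Λ ≤ q a' v.2.1 then
          (if (s v.1).1 = (s a').1 then (1 : ℝ) else 0) else 0) ≤ q a' v.2.1 * (m * (Λ / M)) := by
      intro a'
      have h0 := hq0 a' v.2.1
      by_cases h : a' ≠ v.1 ∧ 1 / Λ ≤ q a' v.2.1
      · simp_rw [if_pos h]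
        rw [sum_coll M ℓ hM v.1 a' h.1, ← hm]
        have h1 : 1 ≤ q a' v.2.1 * Λ := by
          have := h.2
          rwa [div_le_iff₀ hΛ] at this
        calc m / M = 1 * (m / M) := by ring
          _ ≤ (q a' v.2.1 * Λ) * (m / M) := mul_le_mul_of_nonneg_right h1 (by positivity)
          _ = _ := by ring
      · simp_rw [if_neg h]
        simp only [Finset.sum_const_zero]
        positivity
    refine (Finset.sum_le_sum fun a' _ => this a').trans ?_
    rw [← Finset.sum_mul]
    calc _ ≤ 1 * (m * (Λ / M)) := mul_le_mul_of_nonneg_right (hq1 _) (by positivity)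
      _ = _ := one_mul _
  rw [Finset.sum_comm]
  simp_rw [← Finset.sum_mul]
  calc _ ≤ ∑ v, m * ((if q v.1 v.2.1 < 1 / Λ then (1 : ℝ) else 0) + Λ / M) * p v :=
        Finset.sum_le_sum fun v _ => mul_le_mul_of_nonneg_right (hv v) (hp0 v)
    _ = m * ((∑ v : A × B × C, (if q v.1 v.2.1 < 1 / Λ then (1 : ℝ) else 0) * p v)
          + Λ / M * ∑ v, p v) := by
        rw [Finset.mul_sum Finset.univ p, ← Finset.sum_add_distrib, Finset.mul_sum]
        refine Finset.sum_congr rfl fun v _ => ?_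
        ring
    _ = _ := by rw [hp1, mul_one]

lemma sec_bound {A C : Type*} [Fintype A] [Fintype C]
    (g : A → C → ℝ) (hg0 : ∀ a c, 0 ≤ g a c) (q : A → C → ℝ) (pz : C → ℝ) (hz0 : ∀ c, 0 ≤ pz c)
    (hz1 : ∑ c, pz c = 1) (hgq : ∀ a c, g a c ≤ q a c * pz c) (hgz : ∀ c, ∑ a, g a c ≤ pz c)
    (Γ : ℝ) (hΓ : 0 < Γ) (M ℓ : ℕ) (hM : 0 < M) :
    ∑ s : A → Fin M × (Fin ℓ → Bool), ∑ c, ∑ r, |∑ a, g a c * devK M ℓ (s a) r|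
    ≤ (Fintype.card (A → Fin M × (Fin ℓ → Bool)) : ℝ) *
      (2 * (∑ a, ∑ c, (if 1 / Γ < q a c then (1 : ℝ) else 0) * g a c)
        + √(2 * (M * 2 ^ ℓ)) * √(1 / Γ)) := by
  set m : ℝ := (Fintype.card (A → Fin M × (Fin ℓ → Bool)) : ℝ) with hm
  have hm0 : 0 ≤ m := by positivity
  let b : A → C → ℝ := fun a c => (if 1 / Γ < q a c then (1 : ℝ) else 0) * g a c
  let h : A → C → ℝ := fun a c => (if 1 / Γ < q a c then (0 : ℝ) else 1) * g a c
  have hb0 : ∀ a c, 0 ≤ b a c := by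
    intro a c
    apply mul_nonneg _ (hg0 a c)
    split_ifs <;> simp
  have hh0 : ∀ a c, 0 ≤ h a c := by
    intro a c
    apply mul_nonneg _ (hg0 a c)
    split_ifs <;> simp
  have hsplit : ∀ a c, g a c = b a c + h a c := by
    intro a c
    simp only [b, h]
    split_ifs <;> simp
  have hhg : ∀ a c, h a c ≤ g a c := by
    intro a c
    have := hsplit a c
    have := hb0 a c
    linarith
  have hhz : ∀ a c, h a c ≤ pz c / Γ := by
    intro a c
    simp only [h]
    split_ifs with hc
    · rw [zero_mul]; exact div_nonneg (hz0 c) hΓ.le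
    · rw [one_mul]
      refine (hgq a c).trans ?_
      calc _ ≤ 1 / Γ * pz c := mul_le_mul_of_nonneg_right (not_lt.1 hc) (hz0 c)
        _ = _ := by ring
  have hsq : ∀ c, ∑ a, h a c ^ 2 ≤ (pz c * √(1 / Γ)) ^ 2 := by
    intro c
    rw [mul_pow, Real.sq_sqrt (by positivity)]
    calc _ ≤ ∑ a, g a c * (pz c / Γ) := by
          apply Finset.sum_le_sum
          intro a _
          rw [sq]
          exact mul_le_mul (hhg a c) (hhz a c) (hh0 a c) (hg0 a c)
      _ = (∑ a, g a c) * (pz c / Γ) := by rw [Finset.sum_mul]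
      _ ≤ pz c * (pz c / Γ) := mul_le_mul_of_nonneg_right (hgz c) (div_nonneg (hz0 c) hΓ.le)
      _ = _ := by ring
  have hpt : ∀ (s : A → Fin M × (Fin ℓ → Bool)) (c : C), ∑ r, |∑ a, g a c * devK M ℓ (s a) r|
      ≤ 2 * (∑ a, b a c) + ∑ r, |∑ a, h a c * devK M ℓ (s a) r| := by
    intro s c
    have h1 : ∀ r, |∑ a, g a c * devK M ℓ (s a) r|
        ≤ ∑ a, b a c * |devK M ℓ (s a) r| + |∑ a, h a c * devK M ℓ (s a) r| := by
      intro r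
      have : ∑ a, g a c * devK M ℓ (s a) r
          = ∑ a, b a c * devK M ℓ (s a) r + ∑ a, h a c * devK M ℓ (s a) r := by
        rw [← Finset.sum_add_distrib]
        refine Finset.sum_congr rfl fun a _ => ?_
        rw [hsplit]; ring
      rw [this]
      refine (abs_add_le _ _).trans (add_le_add ?_ le_rfl)
      refine (Finset.abs_sum_le_sum_abs _ _).trans (le_of_eq ?_)
      refine Finset.sum_congr rfl fun a _ => ?_
      rw [abs_mul, abs_of_nonneg (hb0 a c)]
    refine (Finset.sum_le_sum fun r _ => h1 r).trans ?_
    rw [Finset.sum_add_distrib]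
    refine add_le_add ?_ le_rfl
    rw [Finset.sum_comm, Finset.mul_sum]
    apply Finset.sum_le_sum
    intro a _
    rw [← Finset.mul_sum]
    have := mul_le_mul_of_nonneg_left (sum_abs_devK M ℓ (s a)) (hb0 a c)
    linarith
  rw [Finset.sum_comm]
  calc _ ≤ ∑ c, m * (2 * (∑ a, b a c) + pz c * (√(2 * (M * 2 ^ ℓ)) * √(1 / Γ))) := by
        apply Finset.sum_le_sum
        intro c _
        refine (Finset.sum_le_sum fun s _ => hpt s c).trans ?_
        rw [Finset.sum_add_distrib, Finset.sum_const, Finset.card_univ, nsmul_eq_mul, ← hm, mul_add]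
        refine add_le_add le_rfl ?_
        have := first_moment M ℓ hM (fun a => h a c) (pz c * √(1 / Γ))
          (mul_nonneg (hz0 c) (Real.sqrt_nonneg _)) (hsq c)
        refine this.trans (le_of_eq ?_)
        rw [← hm]; ring
    _ = _ := by
        rw [← Finset.mul_sum, Finset.sum_add_distrib, ← Finset.mul_sum, ← Finset.sum_mul, hz1,
          one_mul, Finset.sum_comm]

lemma oneShot {A B C : Type*} [Fintype A] [Fintype B] [Fintype C]
    (p : A × B × C → ℝ) (hp0 : ∀ v, 0 ≤ p v) (hp1 : ∑ v, p v = 1)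
    (q : A → B → ℝ) (hq0 : ∀ a b, 0 ≤ q a b) (hq1 : ∀ b, ∑ a, q a b ≤ 1)
    (q' : A → C → ℝ) (pz : C → ℝ) (hz0 : ∀ c, 0 ≤ pz c) (hz1 : ∑ c, pz c = 1)
    (hgq : ∀ a c, ∑ b, p (a, b, c) ≤ q' a c * pz c)
    (hgz : ∀ c, ∑ a, ∑ b, p (a, b, c) ≤ pz c)
    (Λ Γ : ℝ) (hΛ : 0 < Λ) (hΓ : 0 < Γ) (M ℓ : ℕ) (hM : 0 < M) :
    ∃ (m : ℕ) (_ : 0 < m) (f : Fin m → A → Fin M) (kA : Fin m → A → (Fin ℓ → Bool))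
      (kB : Fin m → Fin M → B → (Fin ℓ → Bool)),
      (∑ v ∈ Finset.univ.filter
            (fun v : Fin m × (A × B × C) => kB v.1 (f v.1 v.2.1) v.2.2.1 ≠ kA v.1 v.2.1),
          p (v.2.1, v.2.2.1, v.2.2.2) / (m : ℝ))
        ≤ (∑ v ∈ Finset.univ.filter (fun v : A × B × C => q v.1 v.2.1 < 1 / Λ), p v) + Λ / M
      ∧ SD
          (fun w : (Fin ℓ → Bool) × Fin M × Fin m × C =>
            (∑ xy ∈ Finset.univ.filter
                (fun xy : A × B => kA w.2.2.1 xy.1 = w.1 ∧ f w.2.2.1 xy.1 = w.2.1),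
              p (xy.1, xy.2, w.2.2.2)) / (m : ℝ))
          (fun w : (Fin ℓ → Bool) × Fin M × Fin m × C =>
            (∑ xy ∈ Finset.univ.filter (fun xy : A × B => f w.2.2.1 xy.1 = w.2.1),
              p (xy.1, xy.2, w.2.2.2)) / ((m : ℝ) * 2 ^ ℓ))
        ≤ (∑ v ∈ Finset.univ.filter (fun v : A × B × C => 1 / Γ < q' v.1 v.2.2), p v)
          + (1 / 2) * (√(2 * (M * 2 ^ ℓ)) * √(1 / Γ)) := by
  let S := A → Fin M × (Fin ℓ → Bool)
  have : Nonempty (Fin M) := ⟨⟨0, hM⟩⟩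
  let m := Fintype.card S
  have hm : 0 < m := Fintype.card_pos
  have hm' : (0 : ℝ) < m := by exact_mod_cast hm
  let e : Fin m ≃ S := (Fintype.equivFin S).symm
  refine ⟨m, hm, fun i a => (e i a).1, fun i a => (e i a).2,
    fun i c b => decK M ℓ q Λ (e i) c b, ?_, ?_⟩
  · have h := rel_bound p hp0 hp1 q hq0 hq1 Λ hΛ M ℓ hM
    rw [← e.sum_comp] at h
    rw [Finset.sum_filter, Fintype.sum_prod_type, Finset.sum_filter]
    have h3 : ∑ v : A × B × C, (if q v.1 v.2.1 < 1 / Λ then p v else 0)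
        = ∑ v : A × B × C, (if q v.1 v.2.1 < 1 / Λ then (1 : ℝ) else 0) * p v := by
      refine Finset.sum_congr rfl fun v _ => ?_
      split_ifs <;> simp
    rw [h3]
    have h4 : ∀ i : Fin m, ∀ v : A × B × C,
        (if decK M ℓ q Λ (e i) (e i v.1).1 v.2.1 ≠ (e i v.1).2 then
          p (v.1, v.2.1, v.2.2) / (m : ℝ) else 0)
        = (if decK M ℓ q Λ (e i) (e i v.1).1 v.2.1 ≠ (e i v.1).2 then (1 : ℝ) else 0) * p v
          / (m : ℝ) := by
      intro i v
      split_ifs <;> simp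
    simp_rw [h4, ← Finset.sum_div]
    rw [div_le_iff₀ hm', mul_comm]
    exact h
  · have h := sec_bound (fun a c => ∑ b, p (a, b, c))
      (fun a c => Finset.sum_nonneg fun b _ => hp0 _) q' pz hz0 hz1 hgq hgz Γ hΓ M ℓ hM
    rw [← e.sum_comp] at h
    have h3 : ∑ v ∈ Finset.univ.filter (fun v : A × B × C => 1 / Γ < q' v.1 v.2.2), p v
        = ∑ a, ∑ c, (if 1 / Γ < q' a c then (1 : ℝ) else 0) * ∑ b, p (a, b, c) := by
      rw [Finset.sum_filter, Fintype.sum_prod_type]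
      refine Finset.sum_congr rfl fun a _ => ?_
      rw [Fintype.sum_prod_type, Finset.sum_comm]
      refine Finset.sum_congr rfl fun c _ => ?_
      rw [Finset.mul_sum]
      refine Finset.sum_congr rfl fun b _ => ?_
      split_ifs <;> simp
    rw [h3]
    have h4 : ∀ (k : Fin ℓ → Bool) (c : Fin M) (i : Fin m) (z : C),
        |(∑ xy ∈ Finset.univ.filter
                (fun xy : A × B => (e i xy.1).2 = k ∧ (e i xy.1).1 = c),
              p (xy.1, xy.2, z)) / (m : ℝ)
          - (∑ xy ∈ Finset.univ.filter (fun xy : A × B => (e i xy.1).1 = c),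
              p (xy.1, xy.2, z)) / ((m : ℝ) * 2 ^ ℓ)|
        = |∑ a, (∑ b, p (a, b, z)) * devK M ℓ (e i a) (c, k)| / m := by
      intro k c i z
      rw [← abs_of_pos hm', ← abs_div, abs_of_pos hm']
      congr 1
      rw [← div_div, div_right_comm, ← sub_div]
      congr 1
      rw [Finset.sum_filter, Finset.sum_filter, Fintype.sum_prod_type, Fintype.sum_prod_type,
        Finset.sum_div, ← Finset.sum_sub_distrib]
      refine Finset.sum_congr rfl fun a _ => ?_
      unfold devK
      simp only [Prod.ext_iff]
      by_cases h1 : (e i a).1 = c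
      · by_cases h2 : (e i a).2 = k
        · simp [h1, h2]; ring
        · simp [h1, h2]; ring
      · simp [h1]
    unfold SD
    have h5 : ∑ w : (Fin ℓ → Bool) × Fin M × Fin m × C,
        |(∑ xy ∈ Finset.univ.filter
                (fun xy : A × B => (e w.2.2.1 xy.1).2 = w.1 ∧ (e w.2.2.1 xy.1).1 = w.2.1),
              p (xy.1, xy.2, w.2.2.2)) / (m : ℝ)
          - (∑ xy ∈ Finset.univ.filter (fun xy : A × B => (e w.2.2.1 xy.1).1 = w.2.1),
              p (xy.1, xy.2, w.2.2.2)) / ((m : ℝ) * 2 ^ ℓ)|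
        = (∑ i : Fin m, ∑ z, ∑ r, |∑ a, (∑ b, p (a, b, z)) * devK M ℓ (e i a) r|) / m := by
      simp_rw [h4]
      rw [← Finset.sum_div]
      congr 1
      let F : (Fin ℓ → Bool) → Fin M → Fin m → C → ℝ := fun k c i z =>
        |∑ a, (∑ b, p (a, b, z)) * devK M ℓ (e i a) (c, k)|
      let E : (Fin ℓ → Bool) × Fin M × Fin m × C ≃ Fin m × C × (Fin M × (Fin ℓ → Bool)) :=
        { toFun := fun w => (w.2.2.1, w.2.2.2, (w.2.1, w.1))
          invFun := fun u => (u.2.2.2, u.2.2.1, u.1, u.2.1)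
          left_inv := fun w => rfl
          right_inv := fun u => rfl }
      have h6 : (∑ i : Fin m, ∑ z, ∑ r, |∑ a, (∑ b, p (a, b, z)) * devK M ℓ (e i a) r|)
          = ∑ u : Fin m × C × (Fin M × (Fin ℓ → Bool)), F u.2.2.2 u.2.2.1 u.1 u.2.1 := by
        rw [Fintype.sum_prod_type]
        refine Finset.sum_congr rfl fun i _ => ?_
        rw [Fintype.sum_prod_type]
      rw [h6, ← E.sum_comp]
      exact Finset.sum_congr rfl fun i _ => rfl
    rw [h5]
    have h7 := (div_le_iff₀' hm').2 h
    linarith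

end Protocol

section Tails
open Filter Topology

lemma sum_prod_pi {n : ℕ} {T : Type*} [Fintype T] (F : Fin n → T → ℝ) :
    ∑ x : Fin n → T, ∏ j, F j (x j) = ∏ j, ∑ t, F j t := by
  rw [Finset.prod_univ_sum, Fintype.piFinset_univ]

/-- triples of sequences versus sequences of triples -/
def tripleEquiv (n : ℕ) (𝒳 𝒴 𝒵 : Type*) :
    (Fin n → 𝒳 × 𝒴 × 𝒵) ≃ (Fin n → 𝒳) × (Fin n → 𝒴) × (Fin n → 𝒵) where
  toFun w := (fun j => (w j).1, fun j => (w j).2.1, fun j => (w j).2.2)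
  invFun v := fun j => (v.1 j, v.2.1 j, v.2.2 j)
  left_inv _ := rfl
  right_inv _ := rfl

lemma prod_c_eq {Ω : Type*} {n : ℕ} (c : Ω → ℝ) (H : ℝ) (x : Fin n → Ω)
    (hc : ∀ j, 0 < c (x j)) :
    ∏ j, c (x j) = (2 : ℝ) ^ (-(∑ j, (-Real.logb 2 (c (x j)) - H)) - n * H) := by
  have h1 : -(∑ j, (-Real.logb 2 (c (x j)) - H)) - n * H = ∑ j, Real.logb 2 (c (x j)) := by
    rw [Finset.sum_sub_distrib, Finset.sum_neg_distrib]
    simp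
  rw [h1, Real.rpow_sum_of_pos (by norm_num)]
  refine Finset.prod_congr rfl fun j _ => ?_
  rw [Real.rpow_logb (by norm_num) (by norm_num) (hc j)]

lemma tail_lower {Ω : Type*} [Fintype Ω] (p : Ω → ℝ) (hp0 : ∀ w, 0 ≤ p w) (hp1 : ∑ w, p w = 1)
    (c : Ω → ℝ) (hc : ∀ w, p w ≠ 0 → 0 < c w) (H v : ℝ) (hv : 0 < v)
    (hg0 : ∑ w, p w * (-Real.logb 2 (c w) - H) = 0)
    (hg1 : ∑ w, p w * (-Real.logb 2 (c w) - H) ^ 2 = v) (t : ℝ) :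
    Tendsto (fun n : ℕ => ∑ x ∈ Finset.univ.filter
      (fun x : Fin n → Ω => ∏ j, c (x j) < 1 / (2 : ℝ) ^ (n * H + √(n : ℝ) * (t * √v))),
        ∏ j, p (x j)) atTop (𝓝 (Qtail t)) := by
  refine (clt_fin p hp0 hp1 _ hg0 v hv hg1 t).congr ?_
  intro n
  rw [Finset.sum_filter, Finset.sum_filter]
  refine Finset.sum_congr rfl fun x _ => ?_
  by_cases h0 : ∏ j, p (x j) = 0
  · simp [h0]
  · have hx : ∀ j, 0 < c (x j) := fun j => hc _ fun h => h0 (Finset.prod_eq_zero (Finset.mem_univ j) h)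
    refine if_congr ?_ rfl rfl
    rw [prod_c_eq c H x hx, one_div, ← Real.rpow_neg (by norm_num),
      Real.rpow_lt_rpow_left_iff (by norm_num)]
    constructor <;> intro h <;> linarith

lemma tail_upper {Ω : Type*} [Fintype Ω] (p : Ω → ℝ) (hp0 : ∀ w, 0 ≤ p w) (hp1 : ∑ w, p w = 1)
    (c : Ω → ℝ) (hc : ∀ w, p w ≠ 0 → 0 < c w) (H v : ℝ) (hv : 0 < v)
    (hg0 : ∑ w, p w * (-Real.logb 2 (c w) - H) = 0)
    (hg1 : ∑ w, p w * (-Real.logb 2 (c w) - H) ^ 2 = v) (t : ℝ) :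
    Tendsto (fun n : ℕ => ∑ x ∈ Finset.univ.filter
      (fun x : Fin n → Ω => 1 / (2 : ℝ) ^ (n * H - √(n : ℝ) * (t * √v)) < ∏ j, c (x j)),
        ∏ j, p (x j)) atTop (𝓝 (Qtail t)) := by
  refine (clt_fin p hp0 hp1 (fun w => -(-Real.logb 2 (c w) - H)) ?_ v hv ?_ t).congr ?_
  · simp_rw [mul_neg]
    rw [Finset.sum_neg_distrib, hg0, neg_zero]
  · simp_rw [neg_sq]
    exact hg1
  intro n
  rw [Finset.sum_filter, Finset.sum_filter]
  refine Finset.sum_congr rfl fun x _ => ?_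
  by_cases h0 : ∏ j, p (x j) = 0
  · simp [h0]
  · have hx : ∀ j, 0 < c (x j) := fun j => hc _ fun h => h0 (Finset.prod_eq_zero (Finset.mem_univ j) h)
    refine if_congr ?_ rfl rfl
    rw [prod_c_eq c H x hx, one_div, ← Real.rpow_neg (by norm_num),
      Real.rpow_lt_rpow_left_iff (by norm_num), Finset.sum_neg_distrib]
    constructor <;> intro h <;> linarith

variable {𝒳 𝒴 𝒵 : Type*} [Fintype 𝒳] [Fintype 𝒴] [Fintype 𝒵]

lemma sum_margXY (P : 𝒳 × 𝒴 × 𝒵 → ℝ) (h : 𝒳 × 𝒴 → ℝ) :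
    ∑ w, P w * h (w.1, w.2.1) = ∑ u, margXY P u * h u := by
  unfold margXY
  rw [Fintype.sum_prod_type, Fintype.sum_prod_type]
  refine Finset.sum_congr rfl fun x _ => ?_
  rw [Fintype.sum_prod_type]
  refine Finset.sum_congr rfl fun y _ => ?_
  rw [Finset.sum_mul]

lemma sum_margXZ (P : 𝒳 × 𝒴 × 𝒵 → ℝ) (h : 𝒳 × 𝒵 → ℝ) :
    ∑ w, P w * h (w.1, w.2.2) = ∑ u, margXZ P u * h u := by
  unfold margXZ
  rw [Fintype.sum_prod_type, Fintype.sum_prod_type]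
  refine Finset.sum_congr rfl fun x _ => ?_
  rw [Fintype.sum_prod_type, Finset.sum_comm]
  refine Finset.sum_congr rfl fun y _ => ?_
  rw [Finset.sum_mul]

lemma mean_zero (P : 𝒳 × 𝒴 → ℝ) (hP1 : ∑ w, P w = 1) :
    ∑ u, P u * (-Real.logb 2 (condProb P u.1 u.2) - condEnt P) = 0 := by
  simp_rw [mul_sub, mul_neg]
  rw [Finset.sum_sub_distrib, ← Finset.sum_mul, hP1, one_mul, Finset.sum_neg_distrib,
    Fintype.sum_prod_type]
  simp [condEnt]

lemma condProb_pos (P : 𝒳 × 𝒴 → ℝ) (hP0 : ∀ w, 0 ≤ P w) (a : 𝒳) (b : 𝒴) (h : 0 < P (a, b)) :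
    0 < condProb P a b := by
  unfold condProb
  apply div_pos h
  exact lt_of_lt_of_le h (Finset.single_le_sum (f := fun a' => P (a', b)) (fun i _ => hP0 _)
    (Finset.mem_univ a))

lemma condProb_nonneg (P : 𝒳 × 𝒴 → ℝ) (hP0 : ∀ w, 0 ≤ P w) (a : 𝒳) (b : 𝒴) :
    0 ≤ condProb P a b :=
  div_nonneg (hP0 _) (Finset.sum_nonneg fun i _ => hP0 _)

lemma sum_condProb_le (P : 𝒳 × 𝒴 → ℝ) (b : 𝒴) : ∑ a, condProb P a b ≤ 1 := by
  unfold condProb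
  rw [← Finset.sum_div]
  exact div_self_le_one _

lemma condProb_mul (P : 𝒳 × 𝒴 → ℝ) (hP0 : ∀ w, 0 ≤ P w) (a : 𝒳) (b : 𝒴) :
    condProb P a b * ∑ a', P (a', b) = P (a, b) := by
  unfold condProb
  by_cases h : ∑ a', P (a', b) = 0
  · have := (Finset.sum_eq_zero_iff_of_nonneg (fun i _ => hP0 _)).1 h a (Finset.mem_univ a)
    simp [h, this]
  · rw [div_mul_cancel₀ _ h]

lemma margXY_nonneg (P : 𝒳 × 𝒴 × 𝒵 → ℝ) (hP0 : ∀ w, 0 ≤ P w) : ∀ w, 0 ≤ margXY P w :=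
  fun _ => Finset.sum_nonneg fun _ _ => hP0 _

lemma margXZ_nonneg (P : 𝒳 × 𝒴 × 𝒵 → ℝ) (hP0 : ∀ w, 0 ≤ P w) : ∀ w, 0 ≤ margXZ P w :=
  fun _ => Finset.sum_nonneg fun _ _ => hP0 _

lemma tailXY (P : 𝒳 × 𝒴 × 𝒵 → ℝ) (hP0 : ∀ w, 0 ≤ P w) (hP1 : ∑ w, P w = 1)
    (hΔ : 0 < condVar (margXY P)) (t : ℝ) :
    Tendsto (fun n : ℕ => ∑ v ∈ Finset.univ.filter
      (fun v : (Fin n → 𝒳) × (Fin n → 𝒴) × (Fin n → 𝒵) =>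
        ∏ j, condProb (margXY P) (v.1 j) (v.2.1 j)
          < 1 / (2 : ℝ) ^ (n * condEnt (margXY P) + √(n : ℝ) * (t * √(condVar (margXY P))))),
        ∏ j, P (v.1 j, v.2.1 j, v.2.2 j)) atTop (𝓝 (Qtail t)) := by
  have hm0 := margXY_nonneg P hP0
  have hm1 : ∑ w, margXY P w = 1 := by
    have := sum_margXY P (fun _ => 1)
    simpa [hP1] using this.symm
  refine (tail_lower P hP0 hP1 (fun w => condProb (margXY P) w.1 w.2.1) ?_ _ _ hΔ
    ((sum_margXY P _).trans (mean_zero _ hm1)) (sum_margXY P (fun u =>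
      (-Real.logb 2 (condProb (margXY P) u.1 u.2) - condEnt (margXY P)) ^ 2)) t).congr ?_
  · intro w hw
    apply condProb_pos _ hm0
    exact lt_of_lt_of_le (lt_of_le_of_ne (hP0 w) hw.symm)
      (Finset.single_le_sum (f := fun z => P (w.1, w.2.1, z)) (fun _ _ => hP0 _)
        (Finset.mem_univ w.2.2))
  · intro n
    rw [Finset.sum_filter, Finset.sum_filter, ← (tripleEquiv n 𝒳 𝒴 𝒵).sum_comp]
    exact Finset.sum_congr rfl fun _ _ => rfl

lemma tailXZ (P : 𝒳 × 𝒴 × 𝒵 → ℝ) (hP0 : ∀ w, 0 ≤ P w) (hP1 : ∑ w, P w = 1)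
    (hΔ : 0 < condVar (margXZ P)) (t : ℝ) :
    Tendsto (fun n : ℕ => ∑ v ∈ Finset.univ.filter
      (fun v : (Fin n → 𝒳) × (Fin n → 𝒴) × (Fin n → 𝒵) =>
        1 / (2 : ℝ) ^ (n * condEnt (margXZ P) - √(n : ℝ) * (t * √(condVar (margXZ P))))
          < ∏ j, condProb (margXZ P) (v.1 j) (v.2.2 j)),
        ∏ j, P (v.1 j, v.2.1 j, v.2.2 j)) atTop (𝓝 (Qtail t)) := by
  have hm0 := margXZ_nonneg P hP0
  have hm1 : ∑ w, margXZ P w = 1 := by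
    have := sum_margXZ P (fun _ => 1)
    simpa [hP1] using this.symm
  refine (tail_upper P hP0 hP1 (fun w => condProb (margXZ P) w.1 w.2.2) ?_ _ _ hΔ
    ((sum_margXZ P _).trans (mean_zero _ hm1)) (sum_margXZ P (fun u =>
      (-Real.logb 2 (condProb (margXZ P) u.1 u.2) - condEnt (margXZ P)) ^ 2)) t).congr ?_
  · intro w hw
    apply condProb_pos _ hm0
    exact lt_of_lt_of_le (lt_of_le_of_ne (hP0 w) hw.symm)
      (Finset.single_le_sum (f := fun y => P (w.1, y, w.2.2)) (fun _ _ => hP0 _)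
        (Finset.mem_univ w.2.1))
  · intro n
    rw [Finset.sum_filter, Finset.sum_filter, ← (tripleEquiv n 𝒳 𝒴 𝒵).sum_comp]
    exact Finset.sum_congr rfl fun _ _ => rfl

/-- the one-shot bound specialised to IID sources -/
lemma oneShotIID (P : 𝒳 × 𝒴 × 𝒵 → ℝ) (hP0 : ∀ w, 0 ≤ P w) (hP1 : ∑ w, P w = 1) (n : ℕ)
    (Λ Γ : ℝ) (hΛ : 0 < Λ) (hΓ : 0 < Γ) (M ℓ : ℕ) (hM : 0 < M) :
    ∃ (m : ℕ) (_ : 0 < m) (f : Fin m → (Fin n → 𝒳) → Fin M)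
        (kA : Fin m → (Fin n → 𝒳) → (Fin ℓ → Bool))
        (kB : Fin m → Fin M → (Fin n → 𝒴) → (Fin ℓ → Bool)),
        (∑ v ∈ Finset.univ.filter
            (fun v : Fin m × ((Fin n → 𝒳) × (Fin n → 𝒴) × (Fin n → 𝒵)) =>
              kB v.1 (f v.1 v.2.1) v.2.2.1 ≠ kA v.1 v.2.1),
          (∏ j, P (v.2.1 j, v.2.2.1 j, v.2.2.2 j)) / (m : ℝ))
          ≤ (∑ v ∈ Finset.univ.filter
              (fun v : (Fin n → 𝒳) × (Fin n → 𝒴) × (Fin n → 𝒵) =>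
                ∏ j, condProb (margXY P) (v.1 j) (v.2.1 j) < 1 / Λ),
              ∏ j, P (v.1 j, v.2.1 j, v.2.2 j)) + Λ / M
        ∧
        SD
          (fun w : (Fin ℓ → Bool) × Fin M × Fin m × (Fin n → 𝒵) =>
            (∑ xy ∈ Finset.univ.filter
                (fun xy : (Fin n → 𝒳) × (Fin n → 𝒴) =>
                  kA w.2.2.1 xy.1 = w.1 ∧ f w.2.2.1 xy.1 = w.2.1),
              ∏ j, P (xy.1 j, xy.2 j, w.2.2.2 j)) / (m : ℝ))
          (fun w : (Fin ℓ → Bool) × Fin M × Fin m × (Fin n → 𝒵) =>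
            (∑ xy ∈ Finset.univ.filter
                (fun xy : (Fin n → 𝒳) × (Fin n → 𝒴) => f w.2.2.1 xy.1 = w.2.1),
              ∏ j, P (xy.1 j, xy.2 j, w.2.2.2 j)) / ((m : ℝ) * 2 ^ ℓ))
          ≤ (∑ v ∈ Finset.univ.filter
              (fun v : (Fin n → 𝒳) × (Fin n → 𝒴) × (Fin n → 𝒵) =>
                1 / Γ < ∏ j, condProb (margXZ P) (v.1 j) (v.2.2 j)),
              ∏ j, P (v.1 j, v.2.1 j, v.2.2 j))
            + (1 / 2) * (√(2 * (M * 2 ^ ℓ)) * √(1 / Γ)) := by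
  have hXY := margXY_nonneg P hP0
  have hXZ := margXZ_nonneg P hP0
  have hsy : ∀ (x : Fin n → 𝒳) (z : Fin n → 𝒵),
      ∑ y : Fin n → 𝒴, ∏ j, P (x j, y j, z j) = ∏ j, margXZ P (x j, z j) := by
    intro x z
    exact sum_prod_pi (fun j y => P (x j, y, z j))
  refine oneShot (fun v : (Fin n → 𝒳) × (Fin n → 𝒴) × (Fin n → 𝒵) =>
      ∏ j, P (v.1 j, v.2.1 j, v.2.2 j)) (fun v => Finset.prod_nonneg fun j _ => hP0 _) ?_
    (fun x y => ∏ j, condProb (margXY P) (x j) (y j))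
    (fun x y => Finset.prod_nonneg fun j _ => condProb_nonneg _ hXY _ _) ?_
    (fun x z => ∏ j, condProb (margXZ P) (x j) (z j))
    (fun z => ∏ j, ∑ a, margXZ P (a, z j))
    (fun z => Finset.prod_nonneg fun j _ => Finset.sum_nonneg fun _ _ => hXZ _) ?_ ?_ ?_
    Λ Γ hΛ hΓ M ℓ hM
  · rw [← (tripleEquiv n 𝒳 𝒴 𝒵).sum_comp]
    refine (sum_prod_pi (fun (_ : Fin n) w => P w)).trans ?_
    simp [hP1]
  · intro y
    rw [sum_prod_pi (fun j x => condProb (margXY P) x (y j))]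
    exact Finset.prod_le_one (fun j _ => Finset.sum_nonneg fun _ _ => condProb_nonneg _ hXY _ _)
      (fun j _ => sum_condProb_le _ _)
  · rw [sum_prod_pi (fun (_ : Fin n) z => ∑ a, margXZ P (a, z))]
    have : ∑ z, ∑ a, margXZ P (a, z) = 1 := by
      have := sum_margXZ P (fun _ => 1)
      simp only [mul_one, hP1] at this
      rw [Finset.sum_comm, ← Fintype.sum_prod_type']
      exact this.symm
    simp [this]
  · intro x z
    simp only
    rw [hsy, ← Finset.prod_mul_distrib]
    refine le_of_eq (Finset.prod_congr rfl fun j _ => ?_)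
    rw [condProb_mul _ hXZ]
  · intro z
    simp_rw [hsy]
    rw [sum_prod_pi (fun j x => margXZ P (x, z j))]

end Tails

lemma sum_prod_total {𝒳 𝒴 𝒵 : Type*} [Fintype 𝒳] [Fintype 𝒴] [Fintype 𝒵]
    (P : 𝒳 × 𝒴 × 𝒵 → ℝ) (hP1 : ∑ w, P w = 1) (n : ℕ) :
    ∑ v : (Fin n → 𝒳) × (Fin n → 𝒴) × (Fin n → 𝒵), ∏ j, P (v.1 j, v.2.1 j, v.2.2 j) = 1 := by
  rw [← (tripleEquiv n 𝒳 𝒴 𝒵).sum_comp]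
  refine (sum_prod_pi (fun (_ : Fin n) w => P w)).trans ?_
  simp [hP1]

lemma prod_condProb_le_one {𝒳 𝒴 𝒵 : Type*} [Fintype 𝒳] [Fintype 𝒴] [Fintype 𝒵]
    (P : 𝒳 × 𝒴 × 𝒵 → ℝ) (hP0 : ∀ w, 0 ≤ P w) (n : ℕ) (x : Fin n → 𝒳) (y : Fin n → 𝒴) :
    ∏ j, condProb (margXY P) (x j) (y j) ≤ 1 := by
  have hXY := margXY_nonneg P hP0
  refine Finset.prod_le_one (fun j _ => condProb_nonneg _ hXY _ _) fun j _ => ?_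
  exact (Finset.single_le_sum (f := fun a => condProb (margXY P) a (y j))
    (fun _ _ => condProb_nonneg _ hXY _ _) (Finset.mem_univ (x j))).trans (sum_condProb_le _ _)

/-- Corollary 2: for IID sources, there is a constant `C` such
that for every `n` there is a one-way (single message, public seed) protocol
producing an `(ε,σ)`-secret key of length at least
`n(H(X|Z) − H(X|Y)) − √n(Q⁻¹(ε)√Δ_{X|Y} + Q⁻¹(σ/2)√Δ_{X|Z}) − (3/2)log₂ n − C`;
hence `S^{ow}_{ε,σ}(X^n,Y^n|Z^n)` satisfies this second-order lower bound. -/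
theorem omska_second_order_lower_bound
    {𝒳 𝒴 𝒵 : Type*} [Fintype 𝒳] [Fintype 𝒴] [Fintype 𝒵] [Nonempty 𝒳]
    (P : 𝒳 × 𝒴 × 𝒵 → ℝ) (hP0 : ∀ w, 0 ≤ P w) (hP1 : ∑ w, P w = 1)
    (hΔXY : 0 < condVar (margXY P)) (hΔXZ : 0 < condVar (margXZ P))
    (ε σ : ℝ) (hε : 0 < ε) (hε1 : ε < 1) (hσ : 0 < σ) (hσ1 : σ < 1)
    (α β : ℝ) (hα : Qtail α = ε) (hβ : Qtail β = σ / 2) :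
    ∃ C : ℝ, ∀ n : ℕ, 0 < n →
      ∃ (m M ℓ : ℕ) (_ : 0 < m) (_ : 0 < M)
        (f : Fin m → (Fin n → 𝒳) → Fin M)
        (kA : Fin m → (Fin n → 𝒳) → (Fin ℓ → Bool))
        (kB : Fin m → Fin M → (Fin n → 𝒴) → (Fin ℓ → Bool)),
        -- key length: second-order lower bound
        (ℓ : ℝ) ≥ n * (condEnt (margXZ P) - condEnt (margXY P))
            - Real.sqrt n * (α * Real.sqrt (condVar (margXY P))
                + β * Real.sqrt (condVar (margXZ P)))
            - (3 / 2) * Real.logb 2 n - C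
        ∧
        -- reliability: Pr[K_A ≠ K_B] ≤ ε
        (∑ v ∈ Finset.univ.filter
            (fun v : Fin m × ((Fin n → 𝒳) × (Fin n → 𝒴) × (Fin n → 𝒵)) =>
              kB v.1 (f v.1 v.2.1) v.2.2.1 ≠ kA v.1 v.2.1),
          (∏ j, P (v.2.1 j, v.2.2.1 j, v.2.2.2 j)) / (m : ℝ))
          ≤ ε
        ∧
        -- secrecy: SD((K, F, S, Z^n); (U_ℓ, F, S, Z^n)) ≤ σ
        SD
          (fun w : (Fin ℓ → Bool) × Fin M × Fin m × (Fin n → 𝒵) =>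
            (∑ xy ∈ Finset.univ.filter
                (fun xy : (Fin n → 𝒳) × (Fin n → 𝒴) =>
                  kA w.2.2.1 xy.1 = w.1 ∧ f w.2.2.1 xy.1 = w.2.1),
              ∏ j, P (xy.1 j, xy.2 j, w.2.2.2 j)) / (m : ℝ))
          (fun w : (Fin ℓ → Bool) × Fin M × Fin m × (Fin n → 𝒵) =>
            (∑ xy ∈ Finset.univ.filter
                (fun xy : (Fin n → 𝒳) × (Fin n → 𝒴) => f w.2.2.1 xy.1 = w.2.1),
              ∏ j, P (xy.1 j, xy.2 j, w.2.2.2 j)) / ((m : ℝ) * 2 ^ ℓ))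
          ≤ σ := by
  have hsX : 0 < √(condVar (margXY P)) := Real.sqrt_pos.2 hΔXY
  have hsZ : 0 < √(condVar (margXZ P)) := Real.sqrt_pos.2 hΔXZ
  set HY := condEnt (margXY P) with hHY
  set HZ := condEnt (margXZ P) with hHZ
  set sX := √(condVar (margXY P)) with hsXd
  set sZ := √(condVar (margXZ P)) with hsZd
  -- shifted quantiles: the slack in the secrecy constraint pays for the reliability slack
  let η : ℝ := (σ / 4) * sZ / sX
  have hη : 0 < η := by positivity
  let α' : ℝ := α + η
  let β' : ℝ := β - σ / 4
  have hshift : α' * sX + β' * sZ = α * sX + β * sZ := by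
    simp only [α', β', η]
    field_simp
    ring
  have hQα : Qtail α' < ε := by
    rw [← hα]; exact Qtail_lt _ _ (by simp only [α']; linarith)
  have hQβ : Qtail β' ≤ 3 * σ / 4 := by
    have := Qtail_le_add β' β (by simp only [β']; linarith)
    rw [hβ] at this
    simp only [β'] at this ⊢
    linarith
  let γ : ℝ := (ε - Qtail α') / 2
  have hγ : 0 < γ := by simp only [γ]; linarith
  have hev1 := (tailXY P hP0 hP1 hΔXY α').eventually_le_const (u := ε - γ)
    (by simp only [γ]; linarith)
  have hev2 := (tailXZ P hP0 hP1 hΔXZ β').eventually_le_const (u := 7 * σ / 8) (by linarith)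
  obtain ⟨N, hN⟩ := Filter.eventually_atTop.1 (hev1.and hev2)
  let K0 : ℝ := 32 * (1 / γ + 1) / σ ^ 2
  have hK0 : 0 < K0 := by positivity
  let L : ℕ → ℝ := fun n => n * (HZ - HY) - √(n : ℝ) * (α * sX + β * sZ)
  let C : ℝ := (∑ n ∈ Finset.range N, |L n|) + |Real.logb 2 K0| + 1
  have hC0 : 0 ≤ ∑ n ∈ Finset.range N, |L n| := Finset.sum_nonneg fun _ _ => abs_nonneg _
  have hK1 := le_abs_self (Real.logb 2 K0)
  refine ⟨C, fun n hn => ?_⟩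
  have hlog : 0 ≤ Real.logb 2 (n : ℝ) :=
    Real.logb_nonneg (by norm_num) (by exact_mod_cast hn)
  by_cases hcase : N ≤ n ∧ 0 ≤ L n - Real.logb 2 K0
  · obtain ⟨hNn, hLn⟩ := hcase
    obtain ⟨h1, h2⟩ := hN n hNn
    set lam : ℝ := n * HY + √(n : ℝ) * (α' * sX) with hlam
    set mu : ℝ := n * HZ - √(n : ℝ) * (β' * sZ) with hmu
    have hLeq : L n = mu - lam := by
      simp only [L, hlam, hmu]
      rw [← hshift]; ring
    have hΛ : (0 : ℝ) < 2 ^ lam := by positivity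
    have hΓ : (0 : ℝ) < 2 ^ mu := by positivity
    have hΛ1 : (1 : ℝ) ≤ 2 ^ lam := by
      by_contra hlt
      rw [not_le] at hlt
      have htot := sum_prod_total P hP1 n
      rw [Finset.filter_true_of_mem, htot] at h1
      · linarith
      · intro v _
        refine lt_of_le_of_lt (prod_condProb_le_one P hP0 n v.1 v.2.1) ?_
        rw [lt_div_iff₀ hΛ]; linarith
    let M : ℕ := ⌈(2 : ℝ) ^ lam / γ⌉₊
    have hM : 0 < M := Nat.ceil_pos.2 (by positivity)
    have hM' : (0 : ℝ) < M := by exact_mod_cast hM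
    have hM1 : (2 : ℝ) ^ lam / γ ≤ M := Nat.le_ceil _
    have hM2 : (M : ℝ) ≤ 2 ^ lam * (1 / γ + 1) := by
      have : (M : ℝ) < (2 : ℝ) ^ lam / γ + 1 := Nat.ceil_lt_add_one (by positivity)
      calc (M : ℝ) ≤ (2 : ℝ) ^ lam / γ + 1 := this.le
        _ ≤ (2 : ℝ) ^ lam / γ + 2 ^ lam := by linarith
        _ = _ := by ring
    let ℓ : ℕ := ⌊L n - Real.logb 2 K0⌋₊
    have hl1 : (ℓ : ℝ) ≤ L n - Real.logb 2 K0 := Nat.floor_le hLn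
    have hl2 : L n - Real.logb 2 K0 < ℓ + 1 := Nat.lt_floor_add_one _
    have h2l : (2 : ℝ) ^ ℓ ≤ 2 ^ mu / (2 ^ lam * K0) := by
      rw [← Real.rpow_natCast]
      calc (2 : ℝ) ^ (ℓ : ℝ) ≤ 2 ^ (mu - lam - Real.logb 2 K0) :=
            Real.rpow_le_rpow_of_exponent_le (by norm_num) (by linarith)
        _ = _ := by
            rw [Real.rpow_sub (by norm_num), Real.rpow_sub (by norm_num),
              Real.rpow_logb (by norm_num) (by norm_num) hK0, div_div]
    obtain ⟨m, hm, f, kA, kB, hrel, hsec⟩ :=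
      oneShotIID P hP0 hP1 n (2 ^ lam) (2 ^ mu) hΛ hΓ M ℓ hM
    refine ⟨m, M, ℓ, hm, hM, f, kA, kB, ?_, ?_, ?_⟩
    · simp only [L] at hl2
      simp only [C]
      linarith
    · refine hrel.trans ?_
      have : (2 : ℝ) ^ lam / M ≤ γ := by
        rw [div_le_iff₀ hM']
        rw [div_le_iff₀ hγ] at hM1
        linarith
      linarith
    · refine hsec.trans ?_
      have hprod : √(2 * (M * 2 ^ ℓ)) * √(1 / (2 : ℝ) ^ mu) ≤ σ / 4 := by
        rw [← Real.sqrt_mul (by positivity)]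
        apply Real.sqrt_le_iff.2
        refine ⟨by positivity, ?_⟩
        calc 2 * ((M : ℝ) * 2 ^ ℓ) * (1 / 2 ^ mu)
            ≤ 2 * ((2 ^ lam * (1 / γ + 1)) * (2 ^ mu / (2 ^ lam * K0))) * (1 / 2 ^ mu) := by
              gcongr
          _ = (σ / 4) ^ 2 := by
              have hg : (1 / γ + 1) ≠ 0 := by positivity
              simp only [K0]
              generalize 1 / γ + 1 = g at hg
              field_simp
              norm_num
      linarith
  · refine ⟨1, 1, 0, one_pos, one_pos, fun _ _ => 0, fun _ _ => fun _ => false,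
      fun _ _ _ => fun _ => false, ?_, ?_, ?_⟩
    · have hLC : L n ≤ C := by
        rcases not_and_or.1 hcase with h | h
        · have := Finset.single_le_sum (f := fun k => |L k|) (fun i _ => abs_nonneg _)
            (Finset.mem_range.2 (not_le.1 h))
          have h3 := le_abs_self (L n)
          have h4 := abs_nonneg (Real.logb 2 K0)
          simp only [C]
          linarith
        · simp only [C]
          linarith
      simp only [L] at hLC
      push_cast
      linarith
    · simp only [ne_eq, not_true_eq_false, Finset.filter_false, Finset.sum_empty]
      exact hε.le
    · unfold SD
      rw [Finset.sum_eq_zero]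
      · linarith
      · intro w _
        have : (fun _ : Fin 0 => false) = w.1 := Subsingleton.elim _ _
        simp [this]
end
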